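/- arXiv:1909.13173 — 4 statements merged into one kernel-verified Lean document; each statement's English description precedes it below -/
import Mathlib

section
/- Let p be an odd prime and r an integer with r ≥ 2. Then F(p^r−1, p^r−1) ≡ 0 (mod p^{r+2}), where F(n,k) = (−1)^{n+k} (4n+1) / 4^{3n−k} · C(2n,n)² · C(2n+2k, n+k) · C(n+k, 2k) / C(2k,k). Equivalently, ((4p^r−3)/4^{2p^r−2}) · C(2p^r−2, p^r−1) · C(4p^r−4, 2p^r−2) ≡ 0 (mod p^{r+2}). -/
open Finset

/-- `a ≡ b (mod p^m)` for rationals: the `p`-adic valuation of `a - b` is at least `m`. -/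
def pcong (p m : ℕ) (a b : ℚ) : Prop :=
  a = b ∨ (m : ℤ) ≤ padicValRat p (a - b)

/-- `F(n,k) = (−1)^{n+k} (4n+1) / 4^{3n−k} · C(2n,n)² · C(2n+2k, n+k) · C(n+k, 2k) / C(2k,k)`. -/
def F (n k : ℕ) : ℚ :=
  (-1) ^ (n + k) * (4 * (n : ℚ) + 1) / 4 ^ (3 * n - k) * (((2 * n).choose n : ℕ) : ℚ) ^ 2 *
    (((2 * n + 2 * k).choose (n + k) : ℕ) : ℚ) * (((n + k).choose (2 * k) : ℕ) : ℚ) /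
    (((2 * k).choose k : ℕ) : ℚ)

lemma F_self (n : ℕ) :
    F n n = (((4 * n + 1) * (2 * n).centralBinom * n.centralBinom : ℕ) : ℚ) /
      ((4 ^ (2 * n) : ℕ) : ℚ) := by
  have hc : ((2 * n).choose n : ℚ) ≠ 0 := by
    exact_mod_cast Nat.centralBinom_ne_zero n
  have hsub : 3 * n - n = 2 * n := by omega
  have hadd : 2 * n + 2 * n = 2 * (2 * n) := by ring
  have hsign : (-1 : ℚ) ^ (2 * n) = 1 := by rw [pow_mul]; norm_num
  simp only [F, hsub, hadd, ← two_mul n, hsign, Nat.choose_self, Nat.centralBinom]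
  push_cast
  field_simp

lemma dvd_centralBinom_of_coprime {n q : ℕ} (hn : n + 1 = q) (hq : q.Coprime 2) :
    q ∣ n.centralBinom := by
  have hrec := Nat.succ_mul_centralBinom_succ n
  have hcop : q.Coprime (2 * n + 1) := by
    rw [Nat.coprime_iff_isRelPrime]
    intro d hd hd'
    have h : d ∣ 2 * n + 1 + 1 := by
      rw [show 2 * n + 1 + 1 = 2 * q by omega]
      exact hd.mul_left 2
    exact Nat.isUnit_iff.mpr (Nat.dvd_one.mp ((Nat.dvd_add_right hd').mp h))
  refine (hq.mul_right hcop).dvd_of_dvd_mul_left ?_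
  rw [← hrec, hn]
  exact dvd_mul_right _ _

lemma dvd_mul_centralBinom_two_mul {n q : ℕ} (hn : n + 1 = q) (hq : q.Coprime 2) :
    q ∣ (4 * n + 1) * (2 * n).centralBinom := by
  have hrec₁ := Nat.succ_mul_centralBinom_succ (2 * n)
  have hrec₂ := Nat.succ_mul_centralBinom_succ (2 * n + 1)
  have hcop : q.Coprime (4 * n + 3) := by
    rw [Nat.coprime_iff_isRelPrime]
    intro d hd hd'
    have h : d ∣ 4 * n + 3 + 1 := by
      rw [show 4 * n + 3 + 1 = 4 * q by omega]
      exact hd.mul_left 4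
    exact Nat.isUnit_iff.mpr (Nat.dvd_one.mp ((Nat.dvd_add_right hd').mp h))
  refine ((hq.mul_right hq).mul_right hcop).dvd_of_dvd_mul_left
    ⟨2 * (2 * n + 1) * (2 * n + 1 + 1).centralBinom, ?_⟩
  subst hn
  zify at hrec₁ hrec₂ ⊢
  linear_combination (-2 * (4 * n + 3) : ℤ) * hrec₁ - (2 * n + 1 : ℤ) * hrec₂

theorem stmt_9 (p : ℕ) (hp : p.Prime) (hodd : Odd p) (r : ℕ) (hr : 2 ≤ r) :
    pcong p (r + 2) (F (p ^ r - 1) (p ^ r - 1)) 0 := by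
  have := Fact.mk hp
  have hn : p ^ r - 1 + 1 = p ^ r := Nat.sub_add_cancel (Nat.one_le_pow _ _ hp.pos)
  have hp2 : p.Coprime 2 := Nat.coprime_two_right.mpr hodd
  have hq : (p ^ r).Coprime 2 := hp2.pow_left r
  generalize p ^ r - 1 = n at hn
  have hdvd : p ^ (r + 2) ∣ (4 * n + 1) * (2 * n).centralBinom * n.centralBinom :=
    (pow_dvd_pow p (by omega : r + 2 ≤ r + r)).trans <| by
      rw [pow_add]
      exact mul_dvd_mul (dvd_mul_centralBinom_two_mul hn hq) (dvd_centralBinom_of_coprime hn hq)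
  have hne : (4 * n + 1) * (2 * n).centralBinom * n.centralBinom ≠ 0 :=
    mul_ne_zero (mul_ne_zero (by omega) (Nat.centralBinom_ne_zero _)) (Nat.centralBinom_ne_zero _)
  have hfour : padicValNat p (4 ^ (2 * n)) = 0 :=
    padicValNat.eq_zero_of_not_dvd <| (Nat.Prime.coprime_iff_not_dvd hp).mp <|
      ((hp2.mul_right hp2 : p.Coprime 4)).pow_right _
  right
  rw [sub_zero, F_self, padicValRat.div (by exact_mod_cast hne) (by positivity),
    padicValRat.of_nat, padicValRat.of_nat, hfour]
  rw [Nat.cast_zero, sub_zero]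
  exact_mod_cast (padicValNat_dvd_iff_le hne).mp hdvd
end

section
/- Let p be an odd prime and r an integer with r ≥ 2. Then Σ_{k=1}^{(p^r−1)/2} G(p^r, k) ≡ 0 (mod p^{r+2}), where G(n,k) = (−1)^{n+k} (2n−1)² C(2n−2, n−1)² / (2(n−k) · 4^{3(n−1)−k}) · C(2(n−1+k), n−1+k) · C(n−1+k, 2k) / C(2k,k). -/
open Finset

/-- \`G(n,k) = (−1)^{n+k} (2n−1)² C(2n−2,n−1)² / (2(n−k)·4^{3(n−1)−k}) · C(2(n−1+k),n−1+k) · C(n−1+k,2k) / C(2k,k)\`. -/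
def G (n k : ℕ) : ℚ :=
  (-1) ^ (n + k) * (2 * (n : ℚ) - 1) ^ 2 * (((2 * n - 2).choose (n - 1) : ℕ) : ℚ) ^ 2 /
    (2 * ((n : ℚ) - (k : ℚ)) * 4 ^ (3 * (n - 1) - k)) *
    (((2 * (n - 1 + k)).choose (n - 1 + k) : ℕ) : ℚ) *
    (((n - 1 + k).choose (2 * k) : ℕ) : ℚ) / (((2 * k).choose k : ℕ) : ℚ)

open Nat

theorem pcong_zero_add {p m : ℕ} (hp : p.Prime) {x y : ℚ} (hx : pcong p m x 0)
    (hy : pcong p m y 0) : pcong p m (x + y) 0 := by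
  have := Fact.mk hp
  unfold pcong at *
  simp only [sub_zero] at *
  by_cases h : x + y = 0
  · exact Or.inl h
  rcases hx with rfl | hx
  · simpa using hy
  rcases hy with rfl | hy
  · simpa using Or.inr hx
  exact Or.inr ((le_min hx hy).trans (padicValRat.min_le_padicValRat_add h))

/-- The contribution of a divisor `q` of `n` in Legendre's formula for
`(2 (n - 1 + k))! k!² / ((n - 1 + k)! (2k)!² (n - k)!)` is at least `-1`. -/
theorem floor_sum_le_add_one {q n k : ℕ} (hq : 2 ≤ q) (hqn : q ∣ n) (hk : 1 ≤ k)
    (hkn : k < n) :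
    (n - 1 + k) / q + 2 * (2 * k / q) + (n - k) / q ≤
      2 * (n - 1 + k) / q + 2 * (k / q) + 1 := by
  have hdiv : ∀ x c d, d < q → x = d + q * c → x / q = c := by
    rintro x c d hd rfl
    rw [Nat.add_mul_div_left _ _ (by omega), Nat.div_eq_of_lt hd, zero_add]
  obtain ⟨s, rfl⟩ := hqn
  obtain ⟨a, b, hb, rfl⟩ : ∃ a b, b < q ∧ k = b + q * a :=
    ⟨k / q, k % q, Nat.mod_lt _ (by omega), (Nat.mod_add_div k q).symm⟩
  have has : a < s := lt_of_mul_lt_mul_left (a := q) (by omega) (Nat.zero_le _)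
  obtain ⟨t, rfl⟩ : ∃ t, s = a + 1 + t := ⟨s - (a + 1), by omega⟩
  have hka := hdiv (b + q * a) a b hb rfl
  rcases Nat.eq_zero_or_pos b with rfl | hb0
  · obtain ⟨c, rfl⟩ : ∃ c, a = c + 1 := ⟨a - 1, by
      have : a ≠ 0 := by rintro rfl; simp at hk
      omega⟩
    have h1 := hdiv (q * (c + 1 + 1 + t) - 1 + (0 + q * (c + 1))) (2 * c + 2 + t) (q - 1)
      (by omega) (by ring_nf; omega)
    have h2 := hdiv (2 * (0 + q * (c + 1))) (2 * c + 2) 0 (by omega) (by ring)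
    have h3 := hdiv (q * (c + 1 + 1 + t) - (0 + q * (c + 1))) (1 + t) 0 (by omega)
      (by ring_nf; omega)
    have h4 := hdiv (2 * (q * (c + 1 + 1 + t) - 1 + (0 + q * (c + 1)))) (4 * c + 5 + 2 * t) (q - 2)
      (by omega) (by ring_nf; omega)
    omega
  · have h1 := hdiv (q * (a + 1 + t) - 1 + (b + q * a)) (2 * a + 1 + t) (b - 1)
      (by omega) (by ring_nf; omega)
    have h3 := hdiv (q * (a + 1 + t) - (b + q * a)) t (q - b) (by omega)
      (by ring_nf; omega)
    have h4 : 4 * a + 2 + 2 * t ≤ 2 * (q * (a + 1 + t) - 1 + (b + q * a)) / q := by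
      rw [Nat.le_div_iff_mul_le (by omega)]
      ring_nf; omega
    have h2 : 2 * (b + q * a) / q ≤ 2 * a + 1 := by
      rw [← Nat.lt_add_one_iff, Nat.div_lt_iff_lt_mul (by omega)]
      ring_nf; omega
    omega

theorem padicValNat_factorial_quotient_bound {p r k : ℕ} (hp : p.Prime) (hodd : Odd p)
    (hr : 1 ≤ r) (hk : 1 ≤ k) (hkn : 2 * k < p ^ r) :
    padicValNat p (p ^ r - 1 + k)! + 2 * padicValNat p (2 * k)! + padicValNat p (p ^ r - k)! + 2 ≤
      padicValNat p (2 * (p ^ r - 1 + k))! + 2 * padicValNat p k ! + r := by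
  have := Fact.mk hp
  have hp3 : 3 ≤ p := by
    have := hp.two_le
    obtain ⟨t, rfl⟩ := hodd
    omega
  have hlog : ∀ x, x < 3 * p ^ r → Nat.log p x < r + 1 := fun x hx =>
    Nat.log_lt_of_lt_pow' (by omega) (hx.trans_le (by rw [pow_succ']; gcongr))
  rw [padicValNat_factorial (hlog (p ^ r - 1 + k) (by omega)),
    padicValNat_factorial (hlog (2 * k) (by omega)),
    padicValNat_factorial (hlog (p ^ r - k) (by omega)),
    padicValNat_factorial (hlog (2 * (p ^ r - 1 + k)) (by omega)),
    padicValNat_factorial (hlog k (by omega))]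
  simp only [Finset.sum_Ico_succ_top hr]
  have hlow := Finset.sum_le_sum fun i (hi : i ∈ Ico 1 r) =>
    floor_sum_le_add_one (q := p ^ i) (n := p ^ r) (k := k)
      (hp.two_le.trans (Nat.le_self_pow (by have := Finset.mem_Ico.1 hi; omega) p))
      (pow_dvd_pow p (Finset.mem_Ico.1 hi).2.le) hk (by omega)
  simp only [Finset.sum_add_distrib, ← Finset.mul_sum, Finset.sum_const, Nat.card_Ico,
    smul_eq_mul, mul_one] at hlow
  have h1 : (p ^ r - 1 + k) / p ^ r ≤ 1 := by
    rw [← Nat.lt_add_one_iff, Nat.div_lt_iff_lt_mul (by omega)]; omega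
  have h2 : 2 * k / p ^ r = 0 := Nat.div_eq_of_lt hkn
  have h3 : (p ^ r - k) / p ^ r = 0 := Nat.div_eq_of_lt (by omega)
  have h5 := Nat.zero_le (k / p ^ r)
  have h4 : 2 ≤ 2 * (p ^ r - 1 + k) / p ^ r := by
    rw [Nat.le_div_iff_mul_le (by omega)]; omega
  omega

theorem G_mul_eq {n k : ℕ} (hkn : k < n) :
    G n k * ((2 * 4 ^ (3 * (n - 1) - k) * (n - 1 + k)! * ((2 * k)!) ^ 2 * (n - k)! : ℕ) : ℚ) =
      (((-1) ^ (n + k) * n ^ 2 * (2 * n - 1).choose n ^ 2 * (2 * (n - 1 + k))! * (k !) ^ 2 : ℤ)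
        : ℚ) := by
  obtain ⟨d, rfl⟩ : ∃ d, n = k + d + 1 := ⟨n - k - 1, by omega⟩
  have hc : (2 * ((k + d + 1 : ℕ) : ℚ) - 1) * ((2 * (k + d + 1) - 2).choose (k + d + 1 - 1) : ℕ) =
      (k + d + 1 : ℕ) * ((2 * (k + d + 1) - 1).choose (k + d + 1) : ℕ) := by
    have h := Nat.add_one_mul_choose_eq (2 * (k + d)) (k + d)
    rw [show 2 * (k + d + 1) - 2 = 2 * (k + d) by omega, show k + d + 1 - 1 = k + d by omega,
      show 2 * (k + d + 1) - 1 = 2 * (k + d) + 1 by omega]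
    have h' : ((2 * (k + d) + 1 : ℕ) : ℚ) * ((2 * (k + d)).choose (k + d) : ℕ) =
      ((2 * (k + d) + 1).choose (k + d + 1) : ℕ) * (k + d + 1 : ℕ) := by exact_mod_cast h
    push_cast at h' ⊢
    linear_combination h'
  have e1 : k + d + 1 - 1 + k = 2 * k + d := by omega
  have e2 : k + d + 1 - k = d + 1 := by omega
  have hm : ((2 * (2 * k + d)).choose (2 * k + d) : ℚ) =
      (2 * (2 * k + d))! / ((2 * k + d)! * (2 * k + d)!) := by
    rw [Nat.cast_choose ℚ (by omega), show 2 * (2 * k + d) - (2 * k + d) = 2 * k + d by omega]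
  have hmk : ((2 * k + d).choose (2 * k) : ℚ) = (2 * k + d)! / ((2 * k)! * d !) := by
    rw [Nat.cast_choose ℚ (by omega), show 2 * k + d - 2 * k = d by omega]
  have hk : ((2 * k).choose k : ℚ) = (2 * k)! / (k ! * k !) := by
    rw [Nat.cast_choose ℚ (by omega), show 2 * k - k = k by omega]
  have hsub : ((k + d + 1 : ℕ) : ℚ) - k = d + 1 := by push_cast; ring
  have hf : ∀ x : ℕ, ((x ! : ℕ) : ℚ) ≠ 0 := fun x => by exact_mod_cast x.factorial_ne_zero
  have hd : (d : ℚ) + 1 ≠ 0 := by positivity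
  unfold G
  rw [e1, e2, hm, hmk, hk, hsub, mul_assoc ((-1) ^ (k + d + 1 + k)), ← mul_pow, hc,
    Nat.factorial_succ]
  have := hf (2 * (2 * k + d))
  have := hf (2 * k + d)
  have := hf (2 * k)
  have := hf k
  have := hf d
  push_cast
  field_simp

theorem pcong_G_zero {p r k : ℕ} (hp : p.Prime) (hodd : Odd p) (hr : 1 ≤ r) (hk : 1 ≤ k)
    (hkn : 2 * k < p ^ r) : pcong p (r + 2) (G (p ^ r) k) 0 := by
  have := Fact.mk hp
  have hp2 : padicValNat p 2 = 0 := padicValNat.eq_zero_of_not_dvd fun h => by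
    rw [Nat.prime_dvd_prime_iff_eq hp Nat.prime_two] at h
    subst h
    exact absurd hodd (by decide)
  have hp4 : padicValNat p 4 = 0 := by
    rw [show 4 = 2 ^ 2 by norm_num, padicValNat.pow, hp2, mul_zero]
  have hG := G_mul_eq (n := p ^ r) (k := k) (by omega)
  have hbound := padicValNat_factorial_quotient_bound hp hodd hr hk hkn
  unfold pcong
  rw [sub_zero]
  by_cases h0 : G (p ^ r) k = 0
  · exact Or.inl h0
  right
  have hf := Nat.factorial_ne_zero
  have hchoose : (2 * p ^ r - 1).choose (p ^ r) ≠ 0 := (Nat.choose_pos (by omega)).ne'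
  have hD : 2 * 4 ^ (3 * (p ^ r - 1) - k) * (p ^ r - 1 + k)! * ((2 * k)!) ^ 2 * (p ^ r - k)! ≠ 0 := by
    simp [hf]
  have hval := congrArg (padicValRat p) hG
  rw [padicValRat.mul h0 (by exact_mod_cast hD), padicValRat.of_nat, padicValRat.of_int,
    padicValInt] at hval
  simp only [Int.natAbs_mul, Int.natAbs_pow, Int.natAbs_neg, Int.natAbs_natCast, Int.natAbs_one,
    one_pow, one_mul] at hval
  simp only [padicValNat.mul, padicValNat.pow, hp2, hp4, padicValNat_self,
    ne_eq, mul_eq_zero, pow_eq_zero_iff', hf, hchoose, hp.ne_zero, OfNat.ofNat_ne_zero,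
    not_false_eq_true, false_and, or_self] at hval
  push_cast at hval
  zify at hbound
  have := Int.natCast_nonneg (padicValNat p ((2 * p ^ r - 1).choose (p ^ r)))
  push_cast at this ⊢
  linarith

theorem stmt_10 (p : ℕ) (hp : p.Prime) (hodd : Odd p) (r : ℕ) (hr : 2 ≤ r) :
    pcong p (r + 2) (∑ k ∈ Icc 1 ((p ^ r - 1) / 2), G (p ^ r) k) 0 := by
  refine Finset.sum_induction _ (pcong p (r + 2) · 0) (fun _ _ => pcong_zero_add hp)
    (Or.inl rfl) fun k hk => ?_
  have hk' := Finset.mem_Icc.1 hk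
  have := Nat.pow_pos (n := r) hp.pos
  exact pcong_G_zero hp hodd (by omega) hk'.1 (by omega)
end

section
/- Let p be a prime with p > 3 and r an integer with r ≥ 2. Then G(p^r, (p^r+1)/2) ≡ (−1)^{(p^r−1)/2} · p^r · (1 − 3p·q_p(2)) (mod p^{r+2}), where G(n,k) = (−1)^{n+k} (2n−1)² C(2n−2, n−1)² / (2(n−k) · 4^{3(n−1)−k}) · C(2(n−1+k), n−1+k) · C(n−1+k, 2k) / C(2k,k). -/
open Finset

/-- A closed form of `G (2 h + 1) (h + 1)` in which the factor `2 h + 1` is explicit. -/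
lemma G_odd_half_eq (h : ℕ) (hh : 1 ≤ h) :
    G (2 * h + 1) (h + 1) = (-1) ^ h * ((2 * h + 1 : ℕ) : ℚ) *
      (((4 * h + 1).choose (2 * h) : ℕ) : ℚ) ^ 3 * (((6 * h + 2).choose (2 * h) : ℕ) : ℚ) /
      ((2 ^ (2 * h)) ^ 5 * (((3 * h + 1).choose h : ℕ) : ℚ)) := by
  obtain ⟨g, rfl⟩ : ∃ g, h = g + 1 := ⟨h - 1, by omega⟩
  have sub_half : 2 * (2 * (g + 1) + 1) - 2 = 4 * (g + 1) := by omega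
  have exponent : 3 * (2 * (g + 1) + 1 - 1) - (g + 1 + 1) = 5 * g + 4 := by omega
  have index : 2 * (g + 1) + 1 - 1 + (g + 1 + 1) = 3 * (g + 1) + 1 := by omega
  have sub_one : 2 * (g + 1) + 1 - 1 = 2 * (g + 1) := by omega
  have choose_centre : (((4 * (g + 1)).choose (2 * (g + 1)) : ℕ) : ℚ) =
      (4 * (g + 1)).factorial / ((2 * (g + 1)).factorial * (2 * (g + 1)).factorial) := by
    rw [Nat.cast_choose ℚ (by omega), show 4 * (g + 1) - 2 * (g + 1) = 2 * (g + 1) by omega]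
  have choose_double : (((4 * (g + 1) + 1).choose (2 * (g + 1)) : ℕ) : ℚ) =
      (4 * (g + 1) + 1).factorial / ((2 * (g + 1)).factorial * (2 * (g + 1) + 1).factorial) := by
    rw [Nat.cast_choose ℚ (by omega),
      show 4 * (g + 1) + 1 - 2 * (g + 1) = 2 * (g + 1) + 1 by omega]
  have choose_triple : (((6 * (g + 1) + 2).choose (2 * (g + 1)) : ℕ) : ℚ) =
      (6 * (g + 1) + 2).factorial /
        ((2 * (g + 1)).factorial * (4 * (g + 1) + 1 + 1).factorial) := by
    rw [Nat.cast_choose ℚ (by omega),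
      show 6 * (g + 1) + 2 - 2 * (g + 1) = 4 * (g + 1) + 1 + 1 by omega]
  have choose_half : (((3 * (g + 1) + 1).choose (g + 1) : ℕ) : ℚ) =
      (3 * (g + 1) + 1).factorial / ((g + 1).factorial * (2 * (g + 1) + 1).factorial) := by
    rw [Nat.cast_choose ℚ (by omega),
      show 3 * (g + 1) + 1 - (g + 1) = 2 * (g + 1) + 1 by omega]
  have choose_triple_centre : (((2 * (3 * (g + 1) + 1)).choose (3 * (g + 1) + 1) : ℕ) : ℚ) =
      (6 * (g + 1) + 2).factorial /
        ((3 * (g + 1) + 1).factorial * (3 * (g + 1) + 1).factorial) := by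
    rw [Nat.cast_choose ℚ (by omega),
      show 2 * (3 * (g + 1) + 1) - (3 * (g + 1) + 1) = 3 * (g + 1) + 1 by omega,
      show 2 * (3 * (g + 1) + 1) = 6 * (g + 1) + 2 by omega]
  have choose_mixed : (((3 * (g + 1) + 1).choose (2 * (g + 1 + 1)) : ℕ) : ℚ) =
      (3 * (g + 1) + 1).factorial / ((2 * (g + 1) + 1 + 1).factorial * g.factorial) := by
    rw [Nat.cast_choose ℚ (by omega), show 3 * (g + 1) + 1 - 2 * (g + 1 + 1) = g by omega,
      show 2 * (g + 1 + 1) = 2 * (g + 1) + 1 + 1 by omega]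
  have choose_small : (((2 * (g + 1 + 1)).choose (g + 1 + 1) : ℕ) : ℚ) =
      (2 * (g + 1) + 1 + 1).factorial / ((g + 1 + 1).factorial * (g + 1 + 1).factorial) := by
    rw [Nat.cast_choose ℚ (by omega), show 2 * (g + 1 + 1) - (g + 1 + 1) = g + 1 + 1 by omega,
      show 2 * (g + 1 + 1) = 2 * (g + 1) + 1 + 1 by omega]
  have sign : (-1 : ℚ) ^ (2 * (g + 1) + 1 + (g + 1 + 1)) = (-1) ^ (g + 1) := by
    rw [show 2 * (g + 1) + 1 + (g + 1 + 1) = 2 * (g + 1) + 2 + (g + 1) by omega, pow_add,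
      Even.neg_one_pow ⟨g + 2, by ring⟩, one_mul]
  have four_pow : (4 : ℚ) ^ (5 * g + 4) = (2 ^ (2 * (g + 1))) ^ 5 / 4 := by
    rw [show (4 : ℚ) = 2 ^ 2 by norm_num, ← pow_mul, ← pow_mul, eq_div_iff (by norm_num), ← pow_add]
    congr 1
    ring
  unfold G
  rw [exponent, index, sub_one, sub_half, choose_centre, choose_double, choose_triple, choose_half,
    choose_triple_centre, choose_mixed, choose_small, sign, four_pow]
  have factorial_ne (m : ℕ) : (m.factorial : ℚ) ≠ 0 := by exact_mod_cast m.factorial_ne_zero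
  have h1 := factorial_ne g
  have h2 := factorial_ne (2 * (g + 1))
  have h3 := factorial_ne (3 * (g + 1) + 1)
  have h4 := factorial_ne (4 * (g + 1))
  have h6 := factorial_ne (6 * (g + 1) + 2)
  have difference : 2 * (((2 * (g + 1) + 1 : ℕ) : ℚ) - ((g + 1 + 1 : ℕ) : ℚ)) = 2 * (g + 1) := by
    push_cast
    ring
  rw [difference]
  simp only [Nat.factorial_succ (4 * (g + 1)), Nat.factorial_succ (4 * (g + 1) + 1),
    Nat.factorial_succ (2 * (g + 1)), Nat.factorial_succ (2 * (g + 1) + 1),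
    Nat.factorial_succ g, Nat.factorial_succ (g + 1)]
  push_cast
  generalize ((2 * (g + 1)).factorial : ℚ) = f2 at *
  generalize ((3 * (g + 1) + 1).factorial : ℚ) = f3 at *
  generalize ((4 * (g + 1)).factorial : ℚ) = f4 at *
  generalize ((6 * (g + 1) + 2).factorial : ℚ) = f6 at *
  generalize (g.factorial : ℚ) = f1 at *
  generalize (-1 : ℚ) ^ (g + 1) = s
  have hQ : (2 : ℚ) ^ (2 * (g + 1)) ≠ 0 := by positivity
  generalize (2 : ℚ) ^ (2 * (g + 1)) = Q at *
  have e1 : (g : ℚ) + 1 ≠ 0 := by positivity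
  have e2 : (g : ℚ) + 1 + 1 ≠ 0 := by positivity
  have e3 : 2 * ((g : ℚ) + 1) + 1 ≠ 0 := by positivity
  have e4 : 2 * ((g : ℚ) + 1) + 1 + 1 ≠ 0 := by positivity
  have e5 : 4 * ((g : ℚ) + 1) + 1 ≠ 0 := by positivity
  have e6 : 4 * ((g : ℚ) + 1) + 1 + 1 ≠ 0 := by positivity
  field_simp
  ring

/-- Removing the multiples of `p` from the product formula for `C(p m + b, b)`. -/
lemma exists_choose_mul_eq {p : ℕ} (hp : p.Prime) (m b : ℕ) :
    ∃ u v : ℕ, (p * m + b).choose b * v = (m + b / p).choose (b / p) * u ∧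
      p.Coprime v ∧ u ≡ v [MOD p * m] := by
  induction b with
  | zero => exact ⟨1, 1, by simp, by simp, rfl⟩
  | succ b ih =>
    obtain ⟨u, v, huv, hv, hmod⟩ := ih
    have step : (p * m + (b + 1)).choose (b + 1) * (b + 1) =
        (p * m + b).choose b * (p * m + b + 1) := by
      have := Nat.add_one_mul_choose_eq (p * m + b) b
      rw [← add_assoc]
      linarith
    by_cases hdvd : p ∣ b + 1
    · have hdiv : (b + 1) / p = b / p + 1 := Nat.succ_div_of_dvd hdvd
      refine ⟨u, v, ?_, hv, hmod⟩
      have hb : b + 1 = p * (b / p + 1) := by rw [← hdiv, Nat.mul_div_cancel' hdvd]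
      rw [hdiv]
      set c := b / p
      have step' : (m + (c + 1)).choose (c + 1) * (c + 1) = (m + c).choose c * (m + c + 1) := by
        have := Nat.add_one_mul_choose_eq (m + c) c
        rw [← add_assoc]
        linarith
      apply Nat.eq_of_mul_eq_mul_right (show 0 < p * (c + 1) from Nat.mul_pos hp.pos c.succ_pos)
      calc (p * m + (b + 1)).choose (b + 1) * v * (p * (c + 1))
          = (p * m + (b + 1)).choose (b + 1) * (b + 1) * v := by rw [← hb]; ring
        _ = (p * m + b).choose b * v * (p * m + (b + 1)) := by rw [step]; ring
        _ = (m + c).choose c * (m + c + 1) * u * p := by rw [huv, hb]; ring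
        _ = _ := by rw [← step']; ring
    · refine ⟨u * (p * m + b + 1), v * (b + 1), ?_, ?_, ?_⟩
      · rw [Nat.succ_div_of_not_dvd hdvd]
        calc (p * m + (b + 1)).choose (b + 1) * (v * (b + 1))
            = (p * m + (b + 1)).choose (b + 1) * (b + 1) * v := by ring
          _ = (p * m + b).choose b * v * (p * m + b + 1) := by rw [step]; ring
          _ = _ := by rw [huv]; ring
      · exact Nat.Coprime.mul_right hv ((Nat.Prime.coprime_iff_not_dvd hp).2 hdvd)
      · refine hmod.mul ?_
        rw [add_assoc]
        simp [Nat.ModEq]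

lemma cast_choose_eq_choose_div {p : ℕ} (hp : p.Prime) {m : ℕ} (hm : p ∣ m) (b : ℕ) :
    (((p * m + b).choose b : ℕ) : ZMod (p ^ 2)) = ((m + b / p).choose (b / p) : ℕ) := by
  obtain ⟨u, v, huv, hv, hmod⟩ := exists_choose_mul_eq hp m b
  have hdvd : p ^ 2 ∣ p * m := by rw [sq]; exact Nat.mul_dvd_mul_left p hm
  have hcast : (u : ZMod (p ^ 2)) = v := (ZMod.natCast_eq_natCast_iff _ _ _).2 (hmod.of_dvd hdvd)
  have hunit : IsUnit (v : ZMod (p ^ 2)) :=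
    (ZMod.isUnit_iff_coprime _ _).2 (hv.symm.pow_right 2)
  apply hunit.mul_right_cancel
  rw [← Nat.cast_mul, huv, Nat.cast_mul, hcast]

lemma cast_choose_prime_pow {p : ℕ} (hp : p.Prime) (c s : ℕ) :
    (((c * p ^ (s + 1) + (p ^ (s + 1) - 1)).choose (p ^ (s + 1) - 1) : ℕ) : ZMod (p ^ 2)) =
      ((c * p + (p - 1)).choose (p - 1) : ℕ) := by
  induction s with
  | zero => simp
  | succ s ih =>
    have hdiv : (p ^ (s + 1 + 1) - 1) / p = p ^ (s + 1) - 1 := by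
      have hpos : 0 < p ^ (s + 1) := pow_pos hp.pos _
      obtain ⟨x, hx⟩ : ∃ x, p ^ (s + 1) = x + 1 := ⟨p ^ (s + 1) - 1, by omega⟩
      rw [pow_succ, hx]
      apply Nat.div_eq_of_lt_le
      · have := hp.pos
        simp only [Nat.add_sub_cancel]
        rw [add_mul]
        omega
      · have := hp.pos
        simp only [Nat.add_sub_cancel]
        have : 0 < (x + 1) * p := Nat.mul_pos x.succ_pos hp.pos
        omega
    rw [show c * p ^ (s + 1 + 1) = p * (c * p ^ (s + 1)) by ring,
      cast_choose_eq_choose_div hp (Dvd.intro_left (c * p ^ s) (by ring)), hdiv, ih]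

lemma cast_choose_half_prime_pow {p : ℕ} (hp : p.Prime) (hodd : Odd p) (s : ℕ) :
    (((p ^ (s + 1) + (p ^ (s + 1) - 1) / 2).choose ((p ^ (s + 1) - 1) / 2) : ℕ) :
      ZMod (p ^ 2)) = ((p + (p - 1) / 2).choose ((p - 1) / 2) : ℕ) := by
  induction s with
  | zero => simp
  | succ s ih =>
    have hdiv : (p ^ (s + 1 + 1) - 1) / 2 / p = (p ^ (s + 1) - 1) / 2 := by
      obtain ⟨y, hy⟩ := hodd.pow (n := s + 1)
      obtain ⟨h, rfl⟩ := hodd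
      rw [pow_succ, hy, show ((2 * y + 1) * (2 * h + 1) - 1) / 2 = h + (2 * h + 1) * y by
        rw [show (2 * y + 1) * (2 * h + 1) = 2 * (h + (2 * h + 1) * y) + 1 by ring]; omega,
        Nat.add_mul_div_left _ _ (by omega), Nat.div_eq_of_lt (by omega)]
      omega
    rw [show p ^ (s + 1 + 1) = p * p ^ (s + 1) by ring,
      cast_choose_eq_choose_div hp (Dvd.intro_left (p ^ s) (by ring)),
      show p * p ^ (s + 1) = p ^ (s + 1 + 1) by ring, hdiv, ih]

lemma dvd_choose_mul_of_not_dvd {p : ℕ} (hp : p.Prime) (m : ℕ) {i : ℕ} (hi : ¬ p ∣ i) :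
    p ∣ (m * p).choose i := by
  rcases Nat.eq_zero_or_pos (m * p) with h0 | hpos
  · have hi0 : 0 < i := Nat.pos_of_ne_zero fun h => hi (h ▸ dvd_zero p)
    rw [h0, Nat.choose_eq_zero_of_lt hi0]
    exact dvd_zero p
  · obtain ⟨j, rfl⟩ : ∃ j, i = j + 1 :=
      Nat.exists_eq_succ_of_ne_zero fun h => hi (h ▸ dvd_zero p)
    have h := Nat.add_one_mul_choose_eq (m * p - 1) j
    rw [Nat.sub_add_cancel hpos] at h
    exact (hp.dvd_mul.1 (h ▸ Dvd.dvd.mul_right (Dvd.intro_left m rfl) _)).resolve_right hi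

lemma cast_choose_mul_prime_add {p : ℕ} (hp : p.Prime) (c : ℕ) :
    (((c * p + p).choose p : ℕ) : ZMod (p ^ 2)) = c + 1 := by
  have hp2 : (p : ZMod (p ^ 2)) ^ 2 = 0 := by exact_mod_cast ZMod.natCast_self (p ^ 2)
  induction c with
  | zero => simp
  | succ c ih =>
    have hne : ((p, 0) : ℕ × ℕ) ≠ (0, p) := by simp [hp.ne_zero]
    rw [Nat.add_choose_eq, Nat.cast_sum,
      Finset.sum_eq_add_of_mem (p, 0) (0, p) (by simp) (by simp) hne]
    · have hc : (c + 1) * p = c * p + p := by ring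
      rw [hc]
      push_cast
      simp [ih]
    · rintro ⟨i, j⟩ hij ⟨hi, hj⟩
      rw [HasAntidiagonal.mem_antidiagonal] at hij
      simp only [ne_eq, Prod.mk.injEq] at hij hi hj
      obtain ⟨a, ha⟩ := dvd_choose_mul_of_not_dvd hp (c + 1) (i := i)
        (Nat.not_dvd_of_pos_of_lt (by omega) (by omega))
      obtain ⟨d, hd⟩ := hp.dvd_choose_self (k := j) (by omega) (by omega)
      simp only [ha, hd]
      push_cast
      linear_combination (a : ZMod (p ^ 2)) * d * hp2

lemma cast_choose_mul_prime_add_pred {p : ℕ} (hp : p.Prime) {c : ℕ} (hc : c + 1 < p) :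
    (((c * p + (p - 1)).choose (p - 1) : ℕ) : ZMod (p ^ 2)) = 1 := by
  have hunit : IsUnit ((c + 1 : ℕ) : ZMod (p ^ 2)) :=
    (ZMod.isUnit_iff_coprime _ _).2
      ((Nat.coprime_of_lt_prime (by omega) hc hp).symm.pow_right 2)
  apply hunit.mul_left_cancel
  have step : (c * p + p).choose p = (c + 1) * (c * p + (p - 1)).choose (p - 1) := by
    apply Nat.eq_of_mul_eq_mul_right hp.pos
    have h := Nat.add_one_mul_choose_eq (c * p + (p - 1)) (p - 1)
    rw [add_assoc, Nat.sub_add_cancel hp.one_le] at h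
    rw [← h]
    ring
  rw [← Nat.cast_mul, ← step, cast_choose_mul_prime_add hp]
  simp

/-- A product of first-order perturbations is affine in the size of the perturbation. -/
lemma exists_prod_add_mul_eq {R : Type*} [CommRing R] {e : R} (he : e ^ 2 = 0) (x : ℕ → R)
    (h : ℕ) : ∃ E : R, ∀ t : R,
      ∏ i ∈ range h, (x i + t * e) = ∏ i ∈ range h, x i + t * e * E := by
  induction h with
  | zero => exact ⟨0, by simp⟩
  | succ h ih =>
    obtain ⟨E, hE⟩ := ih
    refine ⟨∏ i ∈ range h, x i + E * x h, fun t => ?_⟩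
    rw [prod_range_succ, prod_range_succ, hE]
    linear_combination t ^ 2 * E * he

lemma centralBinom_mul_factorial (h : ℕ) :
    h.centralBinom * h.factorial = 2 ^ h * ∏ i ∈ range h, (2 * i + 1) := by
  induction h with
  | zero => simp
  | succ h ih =>
    rw [prod_range_succ, Nat.factorial_succ]
    calc (h + 1).centralBinom * ((h + 1) * h.factorial)
        = (h + 1) * (h + 1).centralBinom * h.factorial := by ring
      _ = 2 * (2 * h + 1) * (h.centralBinom * h.factorial) := by
          rw [Nat.succ_mul_centralBinom_succ]; ring
      _ = _ := by rw [ih]; ring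

lemma two_pow_pred_sub_one_sq {p : ℕ} (hp : p.Prime) (hodd : Odd p) :
    ((2 : ZMod (p ^ 2)) ^ (p - 1) - 1) ^ 2 = 0 := by
  have hp2 : (p : ZMod (p ^ 2)) ^ 2 = 0 := by exact_mod_cast ZMod.natCast_self (p ^ 2)
  have hfermat : (2 : ℤ) ^ (p - 1) ≡ 1 [ZMOD p] :=
    Int.ModEq.pow_card_sub_one_eq_one hp
      (by exact_mod_cast Nat.isCoprime_iff_coprime.2 hodd.coprime_two_left)
  obtain ⟨k, hk⟩ := hfermat.symm.dvd
  have hk' := congrArg (Int.cast : ℤ → ZMod (p ^ 2)) hk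
  push_cast at hk'
  rw [hk', mul_pow, hp2, zero_mul]

lemma two_pow_prime_pow_pred {p : ℕ} (hp : p.Prime) (hodd : Odd p) (s : ℕ) :
    (2 : ZMod (p ^ 2)) ^ (p ^ (s + 1) - 1) = 2 ^ (p - 1) := by
  have hcop : Nat.Coprime 2 (p ^ 2) := hodd.coprime_two_left.pow_right 2
  have hunit : IsUnit (2 : ZMod (p ^ 2)) := by
    exact_mod_cast (ZMod.isUnit_iff_coprime 2 (p ^ 2)).2 hcop
  have heuler : (2 : ZMod (p ^ 2)) ^ (p * (p - 1)) = 1 := by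
    have := (ZMod.natCast_eq_natCast_iff _ _ _).2 (Nat.ModEq.pow_totient hcop)
    rw [Nat.totient_prime_pow hp (by norm_num)] at this
    simpa using this
  have hsq : (2 : ZMod (p ^ 2)) ^ (p * p) = 2 ^ p := by
    have hsplit : p * p = p * (p - 1) + p := by
      conv_rhs => rw [← Nat.mul_succ, Nat.succ_eq_add_one, Nat.sub_add_cancel hp.one_le]
    rw [hsplit, pow_add, heuler, one_mul]
  have hpow : (2 : ZMod (p ^ 2)) ^ (p ^ (s + 1)) = 2 ^ p := by
    induction s with
    | zero => simp
    | succ s ih => rw [pow_succ p (s + 1), pow_mul, ih, ← pow_mul, hsq]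
  apply hunit.mul_right_cancel
  rw [← pow_succ, ← pow_succ, Nat.sub_add_cancel hp.one_le,
    Nat.sub_add_cancel (Nat.one_le_pow _ _ hp.pos), hpow]

/-- With `p = 2 h + 1`, `C(p + h, h) ≡ 1 - 2 (2^(p-1) - 1)` modulo `p²`. -/
lemma cast_choose_add_half {p h : ℕ} (hp : p.Prime) (hh : p = 2 * h + 1) :
    (((p + h).choose h : ℕ) : ZMod (p ^ 2)) = 1 - 2 * (2 ^ (p - 1) - 1) := by
  have hp2 : (p : ZMod (p ^ 2)) ^ 2 = 0 := by exact_mod_cast ZMod.natCast_self (p ^ 2)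
  have unit_of_coprime {a : ℕ} (ha : a.Coprime p) : IsUnit (a : ZMod (p ^ 2)) :=
    (ZMod.isUnit_iff_coprime _ _).2 (ha.pow_right 2)
  have hfact : IsUnit (h.factorial : ZMod (p ^ 2)) :=
    unit_of_coprime ((hp.coprime_factorial_of_lt (by omega)).symm)
  have htwo : IsUnit ((2 : ℕ) : ZMod (p ^ 2)) :=
    unit_of_coprime (Nat.coprime_two_left.2 ⟨h, hh⟩)
  obtain ⟨w, hw⟩ := htwo.exists_right_inv
  push_cast at hw
  obtain ⟨E, hE⟩ := exists_prod_add_mul_eq hp2 (fun i => ((i : ZMod (p ^ 2)) + 1)) h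
  have hprod : ∏ i ∈ range h, ((i : ZMod (p ^ 2)) + 1) = h.factorial := by
    rw [← Finset.prod_range_add_one_eq_factorial]
    push_cast
    rfl
  rw [hprod] at hE
  set C : ZMod (p ^ 2) := (((p + h).choose h : ℕ) : ZMod (p ^ 2))
  set X : ZMod (p ^ 2) := (-1) ^ h * (h.centralBinom : ZMod (p ^ 2)) with hX
  set F : ZMod (p ^ 2) := (h.factorial : ZMod (p ^ 2))
  have hpcast : (p : ZMod (p ^ 2)) = 2 * h + 1 := by
    exact_mod_cast congrArg (Nat.cast : ℕ → ZMod (p ^ 2)) hh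
  have hC : F * C = F + p * E := by
    have := hE 1
    rw [one_mul] at this
    rw [← this]
    simp only [F, C]
    rw [← Nat.cast_mul, ← Nat.ascFactorial_eq_factorial_mul_choose, Nat.ascFactorial_eq_prod_range]
    push_cast
    exact prod_congr rfl fun i _ => by ring
  have const_pow (a : ZMod (p ^ 2)) : a ^ h = ∏ _i ∈ range h, a := by simp
  have hneg : F * X = F - p * E := by
    have hdesc : F * (h.centralBinom : ZMod (p ^ 2)) =
        ∏ i ∈ range h, ((p : ZMod (p ^ 2)) - (i + 1)) := by
      simp only [F]
      rw [← Nat.cast_mul, Nat.centralBinom, ← Nat.descFactorial_eq_factorial_mul_choose,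
        Nat.descFactorial_eq_prod_range, Nat.cast_prod]
      refine prod_congr rfl fun i hi => ?_
      rw [Nat.cast_sub (by have := mem_range.1 hi; omega), hpcast]
      push_cast
      ring
    have hsign : ∏ i ∈ range h, ((i : ZMod (p ^ 2)) + 1 + -1 * p) =
        (-1) ^ h * ∏ i ∈ range h, ((p : ZMod (p ^ 2)) - (i + 1)) := by
      rw [const_pow, ← prod_mul_distrib]
      exact prod_congr rfl fun i _ => by ring
    rw [hE, ← hdesc] at hsign
    linear_combination -hsign
  have hhalf : F * X = 4 ^ h * (F - w * p * E) := by
    have hcentral : F * (h.centralBinom : ZMod (p ^ 2)) =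
        2 ^ h * ∏ i ∈ range h, (2 * (i : ZMod (p ^ 2)) + 1) := by
      have := congrArg (Nat.cast : ℕ → ZMod (p ^ 2)) (centralBinom_mul_factorial h)
      push_cast at this
      rw [← this, mul_comm]
    have hsign : (∏ i ∈ range h, ((i : ZMod (p ^ 2)) + 1 + -w * p)) * 2 ^ h =
        (-1) ^ h * ∏ i ∈ range h, (2 * (i : ZMod (p ^ 2)) + 1) := by
      rw [← prod_range_reflect (fun i => (2 * (i : ZMod (p ^ 2)) + 1)),
        const_pow, const_pow, ← prod_mul_distrib, ← prod_mul_distrib]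
      refine prod_congr rfl fun i hi => ?_
      have := mem_range.1 hi
      rw [show h - 1 - i = h - (i + 1) by omega, Nat.cast_sub (by omega)]
      push_cast
      linear_combination (-(p : ZMod (p ^ 2))) * hw - hpcast
    rw [hE] at hsign
    rw [hX, show (4 : ZMod (p ^ 2)) = 2 * 2 by norm_num, mul_pow]
    linear_combination (-1) ^ h * hcentral - 2 ^ h * hsign
  have hQ : (4 : ZMod (p ^ 2)) ^ h = 2 ^ (p - 1) := by
    rw [show p - 1 = 2 * h by omega, pow_mul]
    norm_num
  have hQ2 := two_pow_pred_sub_one_sq hp ⟨h, hh⟩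
  rw [hQ] at hhalf
  set Q : ZMod (p ^ 2) := 2 ^ (p - 1)
  have hCX : C + X = 2 := hfact.mul_left_cancel (by linear_combination hC + hneg)
  have hXQ : 2 * X = Q * (1 + X) := hfact.mul_left_cancel (by
    linear_combination 2 * hhalf + Q * p * E * (-hw) - Q * hneg)
  linear_combination hCX - Q * hXQ - (X + 1) * hQ2

theorem stmt_11 (p : ℕ) (hp : p.Prime) (hp3 : 3 < p) (r : ℕ) (hr : 2 ≤ r) :
    pcong p (r + 2) (G (p ^ r) ((p ^ r + 1) / 2))
      ((-1) ^ ((p ^ r - 1) / 2) * (p : ℚ) ^ r *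
        (1 - 3 * p * (((2 : ℚ) ^ (p - 1) - 1) / (p : ℚ)))) := by
  have hodd : Odd p := hp.odd_of_ne_two (by omega)
  obtain ⟨s, rfl⟩ : ∃ s, r = s + 1 := ⟨r - 1, by omega⟩
  obtain ⟨h, hn⟩ := hodd.pow (n := s + 1)
  obtain ⟨g, hg⟩ := hodd
  have hh : 1 ≤ h := by
    have : p ≤ p ^ (s + 1) := Nat.le_self_pow s.succ_ne_zero p
    omega
  have hA := cast_choose_prime_pow hp 1 s
  have hB := cast_choose_prime_pow hp 2 s
  have hC := cast_choose_half_prime_pow hp ⟨g, hg⟩ s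
  have hQ := two_pow_prime_pow_pred hp ⟨g, hg⟩ s
  have he := two_pow_pred_sub_one_sq hp ⟨g, hg⟩
  rw [cast_choose_mul_prime_add_pred hp (by omega), hn,
    show 1 * (2 * h + 1) + (2 * h + 1 - 1) = 4 * h + 1 by omega, Nat.add_sub_cancel] at hA
  rw [cast_choose_mul_prime_add_pred hp (by omega), hn,
    show 2 * (2 * h + 1) + (2 * h + 1 - 1) = 6 * h + 2 by omega, Nat.add_sub_cancel] at hB
  rw [show (p - 1) / 2 = g by omega, cast_choose_add_half hp hg, hn,
    show (2 * h + 1 - 1) / 2 = h by omega, show 2 * h + 1 + h = 3 * h + 1 by omega] at hC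
  rw [hn, Nat.add_sub_cancel] at hQ
  have hclosed := G_odd_half_eq h hh
  rw [← hn] at hclosed
  rw [show (p ^ (s + 1) + 1) / 2 = h + 1 by omega, show (p ^ (s + 1) - 1) / 2 = h by omega, hclosed]
  set A := (4 * h + 1).choose (2 * h)
  set B := (6 * h + 2).choose (2 * h)
  set C := (3 * h + 1).choose h
  set D : ℕ := (2 ^ (2 * h)) ^ 5 * C with hD
  have hDT : (D : ZMod (p ^ 2)) * (1 - 3 * (2 ^ (p - 1) - 1)) = 1 := by
    rw [hD]
    push_cast
    rw [hC, hQ]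
    generalize (2 : ZMod (p ^ 2)) ^ (p - 1) = Q at he
    linear_combination (6 * Q ^ 5 - 5 * Q ^ 4 - 4 * Q ^ 3 - 3 * Q ^ 2 - 2 * Q - 1) * he
  have hDcop : D.Coprime (p ^ 2) :=
    (ZMod.isUnit_iff_coprime _ _).1 (IsUnit.of_mul_eq_one _ hDT)
  have hDndvd : ¬ p ∣ D :=
    (Nat.Prime.coprime_iff_not_dvd hp).1 (hDcop.coprime_dvd_right (dvd_pow_self p two_ne_zero)).symm
  have hdvd : ((p ^ 2 : ℕ) : ℤ) ∣ (A : ℤ) ^ 3 * B - D * (1 - 3 * (2 ^ (p - 1) - 1)) := by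
    rw [← ZMod.intCast_zmod_eq_zero_iff_dvd]
    push_cast
    rw [hDT, hA, hB]
    ring
  obtain ⟨z, hz⟩ := hdvd
  have hz' := congrArg (Int.cast : ℤ → ℚ) hz
  push_cast at hz'
  have hp0 : (p : ℚ) ≠ 0 := by exact_mod_cast hp.ne_zero
  have hD0 : (D : ℚ) ≠ 0 := by
    exact_mod_cast fun h0 : D = 0 => hDndvd (h0 ▸ dvd_zero p)
  have hDcast : ((2 : ℚ) ^ (2 * h)) ^ 5 * (C : ℚ) = D := by
    rw [hD]
    push_cast
    rfl
  have key : (-1) ^ h * ((p ^ (s + 1) : ℕ) : ℚ) * (A : ℚ) ^ 3 * B / D -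
      (-1) ^ h * (p : ℚ) ^ (s + 1) * (1 - 3 * p * (((2 : ℚ) ^ (p - 1) - 1) / p)) =
      (p : ℚ) ^ (s + 1 + 2) * (((-1) ^ h * z : ℤ) : ℚ) / (D : ℤ) := by
    push_cast
    rw [mul_assoc 3, mul_div_cancel₀ _ hp0]
    field_simp
    linear_combination (p : ℚ) ^ (s + 1) * hz'
  rw [hDcast]
  rcases eq_or_ne z 0 with rfl | hz0
  · left
    rw [← sub_eq_zero, key]
    simp
  · right
    have : Fact p.Prime := ⟨hp⟩
    have hnum : (((-1) ^ h * z : ℤ) : ℚ) ≠ 0 := by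
      exact_mod_cast mul_ne_zero (pow_ne_zero _ (by norm_num)) hz0
    rw [key, padicValRat.div (mul_ne_zero (pow_ne_zero _ hp0) hnum) (by exact_mod_cast hD0),
      padicValRat.mul (pow_ne_zero _ hp0) hnum, padicValRat.pow,
      padicValRat.self hp.one_lt, padicValRat.of_int, padicValRat.of_int, padicValInt.of_nat,
      padicValNat.eq_zero_of_not_dvd hDndvd]
    push_cast
    omega
end

section
/- Let p be a prime with p > 3 and r an integer with r ≥ 2. Then Σ_{k=(p^r+3)/2}^{p^r−1} G(p^r, k) ≡ (−1)^{(p^r−1)/2} · 3·p^{r+1}·q_p(2) (mod p^{r+2}), where G(n,k) = (−1)^{n+k} (2n−1)² C(2n−2, n−1)² / (2(n−k) · 4^{3(n−1)−k}) · C(2(n−1+k), n−1+k) · C(n−1+k, 2k) / C(2k,k). -/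
open Finset

theorem G_eq_choose_quotient (k i : ℕ) :
    G (k + i + 1) k = ((k + i + 1 : ℕ) : ℚ) ^ 2 *
      ((-1) ^ (i + 1) * ((2 * k + 2 * i + 1).choose (k + i) : ℚ) *
        ((4 * k + 4 * i + 3).choose (2 * k + 2 * i + 1) : ℚ) *
        ((2 * k + 2 * i + 1).choose (i + 1) : ℚ) *
        ((2 * k + 2 * i + 1).choose (2 * i + 1) : ℚ) ^ 2 *
        (((4 * k + 4 * i + 3).choose (2 * i + 3) : ℚ))⁻¹ *
        ((((k + i).choose i : ℚ)) ^ 2)⁻¹ *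
        (((i + 1).centralBinom : ℚ) * (4 ^ (2 * k + 3 * i + 1))⁻¹)) / (2 * i + 3 : ℕ) := by
  have e1 : 2 * (k + i + 1) - 2 = (k + i) + (k + i) := by omega
  have e2 : k + i + 1 - 1 = k + i := by omega
  have e3 : 2 * (k + i + k) = (2 * k + i) + (2 * k + i) := by omega
  have e4 : k + i + k = 2 * k + i := by omega
  have e5 : 3 * (k + i) - k = 2 * k + 3 * i := by omega
  have e6 : 2 * k + 2 * i + 1 = (k + i) + (k + i + 1) := by omega
  have e7 : 4 * k + 4 * i + 3 = (2 * k + 2 * i + 1) + (2 * k + 2 * i + 2) := by omega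
  have e8 : 2 * k + 2 * i + 1 = (i + 1) + (2 * k + i) := by omega
  have e9 : 2 * k + 2 * i + 1 = (2 * i + 1) + 2 * k := by omega
  have e10 : 4 * k + 4 * i + 3 = (2 * i + 3) + (4 * k + 2 * i) := by omega
  have e11 : 2 * (i + 1) = (i + 1) + (i + 1) := by omega
  have e12 : 2 * k = k + k := by omega
  have c6 : ((2 * k + 2 * i + 1).choose (k + i) : ℚ) =
      (2 * k + 2 * i + 1).factorial / ((k + i).factorial * (k + i + 1).factorial) := by
    rw [e6, Nat.cast_add_choose]
  have c7 : ((4 * k + 4 * i + 3).choose (2 * k + 2 * i + 1) : ℚ) = (4 * k + 4 * i + 3).factorial /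
      ((2 * k + 2 * i + 1).factorial * (2 * k + 2 * i + 2).factorial) := by
    rw [e7, Nat.cast_add_choose]
  have c8 : ((2 * k + 2 * i + 1).choose (i + 1) : ℚ) =
      (2 * k + 2 * i + 1).factorial / ((i + 1).factorial * (2 * k + i).factorial) := by
    rw [e8, Nat.cast_add_choose]
  have c9 : ((2 * k + 2 * i + 1).choose (2 * i + 1) : ℚ) =
      (2 * k + 2 * i + 1).factorial / ((2 * i + 1).factorial * (2 * k).factorial) := by
    rw [e9, Nat.cast_add_choose]
  have c10 : ((4 * k + 4 * i + 3).choose (2 * i + 3) : ℚ) =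
      (4 * k + 4 * i + 3).factorial / ((2 * i + 3).factorial * (4 * k + 2 * i).factorial) := by
    rw [e10, Nat.cast_add_choose]
  have c11 : ((i + 1).centralBinom : ℚ) =
      (2 * i + 2).factorial / ((i + 1).factorial * (i + 1).factorial) := by
    rw [Nat.centralBinom, e11, Nat.cast_add_choose, ← e11]; rfl
  have c12 : ((2 * k).choose k : ℚ) = (2 * k).factorial / (k.factorial * k.factorial) := by
    rw [e12, Nat.cast_add_choose]
  have c13 : ((k + i).choose i : ℚ) = (k + i).factorial / (k.factorial * i.factorial) := by
    rw [Nat.add_comm k i, Nat.cast_add_choose, mul_comm (i.factorial : ℚ)]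
  have c1 : ((2 * (k + i + 1) - 2).choose (k + i) : ℚ) =
      (2 * k + 2 * i).factorial / ((k + i).factorial * (k + i).factorial) := by
    rw [e1, Nat.cast_add_choose, show 2 * k + 2 * i = k + i + (k + i) by ring]
  have c3 : ((2 * (k + i + k)).choose (k + i + k) : ℚ) =
      (4 * k + 2 * i).factorial / ((2 * k + i).factorial * (2 * k + i).factorial) := by
    rw [e3, e4, Nat.cast_add_choose, show 4 * k + 2 * i = 2 * k + i + (2 * k + i) by ring]
  have c4 : ((2 * k + i).choose (2 * k) : ℚ) =
      (2 * k + i).factorial / ((2 * k).factorial * i.factorial) := by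
    rw [Nat.cast_add_choose]
  have f1 : ((2 * k + 2 * i + 2).factorial : ℚ) =
      (2 * k + 2 * i + 2) * ((2 * k + 2 * i + 1) * (2 * k + 2 * i).factorial) := by
    rw [Nat.factorial_succ, Nat.factorial_succ]; push_cast; ring
  have f2 : ((2 * k + 2 * i + 1).factorial : ℚ) =
      (2 * k + 2 * i + 1) * (2 * k + 2 * i).factorial := by
    rw [Nat.factorial_succ]; push_cast; ring
  have f3 : ((2 * i + 3).factorial : ℚ) =
      (2 * i + 3) * ((2 * i + 2) * (2 * i + 1).factorial) := by
    rw [Nat.factorial_succ, Nat.factorial_succ]; push_cast; ring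
  have f4 : ((2 * i + 2).factorial : ℚ) = (2 * i + 2) * (2 * i + 1).factorial := by
    rw [Nat.factorial_succ]; push_cast; ring
  have f5 : ((i + 1).factorial : ℚ) = (i + 1) * i.factorial := by
    rw [Nat.factorial_succ]; push_cast; ring
  have f6 : ((k + i + 1).factorial : ℚ) = (k + i + 1) * (k + i).factorial := by
    rw [Nat.factorial_succ]; push_cast; ring
  have sgn : (-1 : ℚ) ^ (k + i + 1 + k) = (-1) ^ (i + 1) := by
    rw [show k + i + 1 + k = 2 * k + (i + 1) by ring, pow_add, pow_mul]; norm_num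
  have g : ∀ m : ℕ, (m.factorial : ℚ) ≠ 0 := fun m => by exact_mod_cast m.factorial_ne_zero
  rw [G, e2, sgn, e5, c6, c7, c8, c9, c10, c11, c12, c13, c1, c3, e4, c4, f1, f2, f3, f4,
    f5, f6]
  have g1 := g (2 * k + 2 * i)
  have g2 := g (2 * i + 1)
  have g3 := g i
  have g4 := g (k + i)
  have g5 := g k
  have g6 := g (2 * k)
  have g7 := g (2 * k + i)
  have g8 := g (4 * k + 2 * i)
  have g9 := g (4 * k + 4 * i + 3)
  have h1 : (2 * k + 2 * i + 1 : ℚ) ≠ 0 := by positivity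
  have h2 : (2 * k + 2 * i + 2 : ℚ) ≠ 0 := by positivity
  have h3 : (2 * i + 3 : ℚ) ≠ 0 := by positivity
  have h4 : (2 * i + 2 : ℚ) ≠ 0 := by positivity
  have h5 : (i + 1 : ℚ) ≠ 0 := by positivity
  have h6 : (k + i + 1 : ℚ) ≠ 0 := by positivity
  generalize (2 * k + 2 * i).factorial = x1 at *
  generalize (2 * i + 1).factorial = x2 at *
  generalize i.factorial = x3 at *
  generalize (k + i).factorial = x4 at *
  generalize k.factorial = x5 at *
  generalize (2 * k).factorial = x6 at *
  generalize (2 * k + i).factorial = x7 at *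
  generalize (4 * k + 2 * i).factorial = x8 at *
  generalize (4 * k + 4 * i + 3).factorial = x9 at *
  push_cast
  have h7 : (k + i + 1 - k : ℚ) = i + 1 := by ring
  rw [h7, show 2 * ((k : ℚ) + i + 1) - 1 = 2 * k + 2 * i + 1 by ring,
    show 2 * (k : ℚ) + 2 * i + 2 = 2 * (k + i + 1) by ring,
    show 2 * (i : ℚ) + 2 = 2 * (i + 1) by ring, pow_succ (4 : ℚ) (2 * k + 3 * i)]
  field_simp
  norm_num

/-- The rational number `x` is `p`-integral and reduces to `a` modulo `p`. -/
def ReducesTo (p : ℕ) (x : ℚ) (a : ZMod p) : Prop :=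
  ∃ m d : ℤ, (d : ZMod p) ≠ 0 ∧ x * d = m ∧ a * d = m

namespace ReducesTo

variable {p : ℕ} [Fact p.Prime] {x y : ℚ} {a b : ZMod p}

theorem intCast (m : ℤ) : ReducesTo p m m := ⟨m, 1, by simp, by simp, by simp⟩

theorem natCast (m : ℕ) : ReducesTo p m m := by simpa using intCast (p := p) m

theorem add (hx : ReducesTo p x a) (hy : ReducesTo p y b) : ReducesTo p (x + y) (a + b) := by
  obtain ⟨m, d, hd, h1, h2⟩ := hx
  obtain ⟨n, e, he, h3, h4⟩ := hy
  refine ⟨m * e + n * d, d * e, ?_, ?_, ?_⟩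
  · push_cast; exact mul_ne_zero hd he
  · push_cast; rw [← h1, ← h3]; ring
  · push_cast; rw [← h2, ← h4]; ring

theorem mul (hx : ReducesTo p x a) (hy : ReducesTo p y b) : ReducesTo p (x * y) (a * b) := by
  obtain ⟨m, d, hd, h1, h2⟩ := hx
  obtain ⟨n, e, he, h3, h4⟩ := hy
  refine ⟨m * n, d * e, ?_, ?_, ?_⟩
  · push_cast; exact mul_ne_zero hd he
  · push_cast; rw [← h1, ← h3]; ring
  · push_cast; rw [← h2, ← h4]; ring

theorem pow (hx : ReducesTo p x a) (n : ℕ) : ReducesTo p (x ^ n) (a ^ n) := by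
  induction n with
  | zero => simpa using natCast (p := p) 1
  | succ n ih => rw [pow_succ, pow_succ]; exact ih.mul hx

theorem inv (hx : ReducesTo p x a) (ha : a ≠ 0) : ReducesTo p x⁻¹ a⁻¹ := by
  obtain ⟨m, d, hd, h1, h2⟩ := hx
  have hm : (m : ZMod p) ≠ 0 := h2 ▸ mul_ne_zero ha hd
  have hx0 : x ≠ 0 := by
    rintro rfl
    apply hm
    have : m = 0 := by exact_mod_cast (by simpa using h1.symm : (m : ℚ) = 0)
    simp [this]
  refine ⟨d, m, hm, ?_, ?_⟩
  · rw [← h1]; field_simp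
  · rw [← h2]; field_simp

theorem div (hx : ReducesTo p x a) (hy : ReducesTo p y b) (hb : b ≠ 0) :
    ReducesTo p (x / y) (a / b) := by
  rw [div_eq_mul_inv, div_eq_mul_inv]; exact hx.mul (hy.inv hb)

theorem sum {ι : Type*} (s : Finset ι) {f : ι → ℚ} {g : ι → ZMod p}
    (h : ∀ i ∈ s, ReducesTo p (f i) (g i)) : ReducesTo p (∑ i ∈ s, f i) (∑ i ∈ s, g i) := by
  classical
  induction s using Finset.induction_on with
  | empty => simpa using natCast (p := p) 0
  | insert i s hi ih =>
    rw [Finset.sum_insert hi, Finset.sum_insert hi]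
    exact (h i (by simp)).add (ih fun j hj => h j (by simp [hj]))

theorem pcong_pow_mul (hx : ReducesTo p x a) (hy : ReducesTo p y a) (m : ℕ) :
    pcong p (m + 1) ((p : ℚ) ^ m * x) ((p : ℚ) ^ m * y) := by
  have hp : p.Prime := Fact.out
  obtain ⟨s, d, hd, h1, h2⟩ := hx
  obtain ⟨t, e, he, h3, h4⟩ := hy
  by_cases hxy : x = y
  · exact Or.inl (by rw [hxy])
  right
  have key : ((s * e - t * d : ℤ) : ZMod p) = 0 := by
    push_cast; rw [← h2, ← h4]; ring
  obtain ⟨w, hw⟩ := (ZMod.intCast_zmod_eq_zero_iff_dvd _ p).1 key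
  have hd0 : (d : ℚ) ≠ 0 := by
    intro h; apply hd; have : d = 0 := by exact_mod_cast h
    simp [this]
  have he0 : (e : ℚ) ≠ 0 := by
    intro h; apply he; have : e = 0 := by exact_mod_cast h
    simp [this]
  have hp0 : (p : ℚ) ≠ 0 := by exact_mod_cast hp.ne_zero
  have hval : ∀ c : ℤ, (c : ZMod p) ≠ 0 → padicValRat p (c : ℚ) = 0 := by
    intro c hc
    rw [padicValRat.of_int, padicValInt.eq_zero_of_not_dvd]
    · rfl
    · rwa [← ZMod.intCast_zmod_eq_zero_iff_dvd]
  have hdiff : ((p : ℚ) ^ m * x - (p : ℚ) ^ m * y) * (d * e) = (p : ℚ) ^ (m + 1) * w := by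
    have : ((s * e - t * d : ℤ) : ℚ) = ((p * w : ℤ) : ℚ) := by rw [hw]
    push_cast at this
    rw [pow_succ, mul_assoc ((p : ℚ) ^ m), ← this, ← h1, ← h3]; ring
  have hne : (p : ℚ) ^ m * x - (p : ℚ) ^ m * y ≠ 0 := by
    rw [← mul_sub]; exact mul_ne_zero (pow_ne_zero _ hp0) (sub_ne_zero.2 hxy)
  have hw0 : (w : ℚ) ≠ 0 := by
    intro h
    rw [h, mul_zero] at hdiff
    exact mul_ne_zero hne (mul_ne_zero hd0 he0) hdiff
  have := congrArg (padicValRat p) hdiff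
  rw [padicValRat.mul hne (mul_ne_zero hd0 he0), padicValRat.mul hd0 he0, hval d hd, hval e he,
    padicValRat.mul (pow_ne_zero _ hp0) hw0, padicValRat.pow, padicValRat.self hp.one_lt,
    padicValRat.of_int] at this
  push_cast at this ⊢
  have h0 : (0 : ℤ) ≤ (padicValInt p w : ℤ) := by positivity
  linarith

end ReducesTo

section BinomialsModPrime

variable {p : ℕ} [Fact p.Prime]

theorem choose_mul_prime_pow_sub_one (N r m : ℕ) (hN : 0 < N) (hm : m < p ^ r) :
    ((N * p ^ r - 1).choose m : ZMod p) = (-1) ^ m := by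
  have hp : p.Prime := Fact.out
  induction m with
  | zero => simp
  | succ m ih =>
    have hpos : 0 < N * p ^ r := Nat.mul_pos hN (pow_pos hp.pos r)
    have h0 : ((N * p ^ r).choose (m + 1) : ZMod p) = 0 := by
      rw [ZMod.natCast_eq_zero_iff]
      by_contra hnd
      have hdvd : p ^ r ∣ (N * p ^ r).choose (m + 1) * (m + 1) := by
        have := Nat.add_one_mul_choose_eq (N * p ^ r - 1) m
        rw [Nat.sub_add_cancel hpos] at this
        rw [← this]
        exact Dvd.dvd.mul_right (Dvd.intro_left _ rfl) _
      have := (Nat.Coprime.pow_left r ((hp.coprime_iff_not_dvd).2 hnd)).dvd_of_dvd_mul_left hdvd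
      exact absurd (Nat.le_of_dvd (by omega) this) (by omega)
    have hrec := Nat.choose_succ_succ (N * p ^ r - 1) m
    rw [Nat.succ_eq_add_one, Nat.sub_add_cancel hpos] at hrec
    have h1 := congrArg (Nat.cast : ℕ → ZMod p) hrec
    rw [Nat.succ_eq_add_one, h0] at h1
    push_cast at h1
    rw [ih (by omega)] at h1
    rw [pow_succ]
    linear_combination -h1

theorem choose_mul_prime_pow_add (r a b c d : ℕ) (hb : b < p ^ r) (hd : d < p ^ r) :
    ((a * p ^ r + b).choose (c * p ^ r + d) : ZMod p) = a.choose c * b.choose d := by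
  have hp : p.Prime := Fact.out
  induction r generalizing b d with
  | zero =>
    simp only [pow_zero, Nat.lt_one_iff] at hb hd
    simp [hb, hd]
  | succ r ih =>
    have step : ∀ n k : ℕ, (n.choose k : ZMod p) = (n % p).choose (k % p) * (n / p).choose (k / p) := by
      intro n k
      have := (ZMod.natCast_eq_natCast_iff _ _ _).2
        (Choose.choose_modEq_choose_mod_mul_choose_div_nat (n := n) (k := k) (p := p))
      simpa using this
    have hmod : ∀ a b : ℕ, (a * p ^ (r + 1) + b) % p = b % p := by
      intro a b
      rw [show a * p ^ (r + 1) + b = b + p * (a * p ^ r) by ring, Nat.add_mul_mod_self_left]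
    have hdiv : ∀ a b : ℕ, (a * p ^ (r + 1) + b) / p = a * p ^ r + b / p := by
      intro a b
      rw [show a * p ^ (r + 1) + b = b + p * (a * p ^ r) by ring, Nat.add_mul_div_left _ _ hp.pos,
        Nat.add_comm]
    have hlt : ∀ b, b < p ^ (r + 1) → b / p < p ^ r := by
      intro b hb
      exact Nat.div_lt_of_lt_mul (by rwa [pow_succ, mul_comm] at hb)
    rw [step, hmod, hmod, hdiv, hdiv, ih _ _ (hlt b hb) (hlt d hd), step b d]
    ring

theorem natCast_ne_zero_of_pos_of_lt {k : ℕ} (h0 : 0 < k) (h : k < p) : (k : ZMod p) ≠ 0 := by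
  rw [Ne, ZMod.natCast_eq_zero_iff]
  exact fun hd => absurd (Nat.le_of_dvd h0 hd) (by omega)

theorem two_ne_zero_zmod (hp2 : p ≠ 2) : (2 : ZMod p) ≠ 0 := by
  have hp : p.Prime := Fact.out
  have := natCast_ne_zero_of_pos_of_lt (p := p) (k := 2) (by omega)
    (by have := hp.two_le; omega)
  simpa using this

theorem sum_range_alternating_choose_div (h : ℕ) (hh : h < p) :
    ∑ t ∈ range h, (-1 : ZMod p) ^ t * h.choose (t + 1) / ((t + 1 : ℕ) : ZMod p) =
      ∑ t ∈ range h, (((t + 1 : ℕ) : ZMod p))⁻¹ := by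
  induction h with
  | zero => simp
  | succ h ih =>
    have hh0 : ((h + 1 : ℕ) : ZMod p) ≠ 0 := natCast_ne_zero_of_pos_of_lt (by omega) hh
    have alt : ∑ t ∈ range (h + 1), (-1 : ZMod p) ^ t * (h + 1).choose (t + 1) = 1 := by
      have := Int.alternating_sum_range_choose_of_ne (n := h + 1) (by omega)
      rw [sum_range_succ'] at this
      have h2 := congrArg (Int.cast : ℤ → ZMod p) this
      push_cast at h2
      simp only [pow_succ, Nat.choose_zero_right, Nat.cast_one, mul_one] at h2
      have h3 : ∑ x ∈ range (h + 1), (-1 : ZMod p) ^ x * -1 * ((h + 1).choose (x + 1) : ZMod p) =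
          - ∑ x ∈ range (h + 1), (-1 : ZMod p) ^ x * ((h + 1).choose (x + 1) : ZMod p) := by
        rw [← sum_neg_distrib]; exact sum_congr rfl fun x _ => by ring
      rw [h3] at h2
      linear_combination -h2
    have split : ∀ t ∈ range (h + 1),
        (-1 : ZMod p) ^ t * (h + 1).choose (t + 1) / ((t + 1 : ℕ) : ZMod p) =
        (-1 : ZMod p) ^ t * h.choose (t + 1) / ((t + 1 : ℕ) : ZMod p) +
        (-1 : ZMod p) ^ t * (h + 1).choose (t + 1) * (((h + 1 : ℕ) : ZMod p))⁻¹ := by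
      intro t ht
      have ht0 : ((t + 1 : ℕ) : ZMod p) ≠ 0 :=
        natCast_ne_zero_of_pos_of_lt (by omega) (by have := mem_range.1 ht; omega)
      have e1 := congrArg (Nat.cast : ℕ → ZMod p) (Nat.choose_succ_succ h t)
      have e2 := congrArg (Nat.cast : ℕ → ZMod p) (Nat.add_one_mul_choose_eq h t)
      simp only [Nat.succ_eq_add_one, Nat.cast_add] at e1
      rw [Nat.cast_mul, Nat.cast_mul] at e2
      field_simp
      linear_combination (((h + 1 : ℕ) : ZMod p)) * e1 + e2
    rw [sum_congr rfl split, sum_add_distrib, ← sum_mul, alt, sum_range_succ, ih (by omega),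
      sum_range_succ]
    simp

theorem fermatQuotient_eq_alternating_sum (q : ℕ) (hq : 2 ^ (p - 1) = p * q + 1) :
    2 * (q : ZMod p) = ∑ k ∈ range (p - 1), (-1) ^ k * (((k + 1 : ℕ) : ZMod p))⁻¹ := by
  have hp : p.Prime := Fact.out
  have hsum := Nat.sum_range_choose p
  obtain ⟨n, rfl⟩ : ∃ n, p = n + 1 := ⟨p - 1, by have := hp.pos; omega⟩
  simp only [Nat.add_sub_cancel] at hq ⊢
  have hdvd : ∀ k ∈ range n, (n + 1).choose (k + 1) = (n + 1) * ((n + 1).choose (k + 1) / (n + 1)) := by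
    intro k hk
    have := mem_range.1 hk
    exact (Nat.mul_div_cancel' (hp.dvd_choose_self (by omega) (by omega))).symm
  rw [sum_range_succ, sum_range_succ', sum_congr rfl hdvd, ← mul_sum, pow_succ, hq] at hsum
  simp only [Nat.choose_zero_right, Nat.choose_self] at hsum
  have h2 : ∑ k ∈ range n, (n + 1).choose (k + 1) / (n + 1) = 2 * q := by
    have : (n + 1) * (∑ k ∈ range n, (n + 1).choose (k + 1) / (n + 1)) = (n + 1) * (2 * q) := by
      linarith
    exact Nat.eq_of_mul_eq_mul_left (by omega) this
  have h3 := congrArg (Nat.cast : ℕ → ZMod (n + 1)) h2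
  rw [Nat.cast_mul, Nat.cast_sum] at h3
  have h4 : ((2 : ℕ) : ZMod (n + 1)) = 2 := by norm_num
  rw [h4] at h3
  rw [← h3]
  refine sum_congr rfl fun k hk => ?_
  have hkn := mem_range.1 hk
  have hk0 : ((k + 1 : ℕ) : ZMod (n + 1)) ≠ 0 :=
    natCast_ne_zero_of_pos_of_lt (by omega) (by omega)
  rw [eq_mul_inv_iff_mul_eq₀ hk0, ← Nat.cast_mul]
  have h5 : (n + 1).choose (k + 1) / (n + 1) * (k + 1) = n.choose k := by
    apply Nat.eq_of_mul_eq_mul_left (show 0 < n + 1 by omega)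
    rw [← mul_assoc, ← hdvd k hk]
    exact (Nat.add_one_mul_choose_eq n k).symm
  rw [h5]
  have := choose_mul_prime_pow_sub_one (p := n + 1) 1 1 k (by omega) (by rw [pow_one]; omega)
  simpa using this

theorem sum_inv_eq_zero (hp2 : p ≠ 2) :
    ∑ k ∈ range (p - 1), (((k + 1 : ℕ) : ZMod p))⁻¹ = 0 := by
  have h2 := two_ne_zero_zmod (p := p) (by omega)
  have hr : ∑ k ∈ range (p - 1), (((k + 1 : ℕ) : ZMod p))⁻¹ =
      ∑ k ∈ range (p - 1), -(((k + 1 : ℕ) : ZMod p))⁻¹ := by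
    rw [← sum_range_reflect]
    refine sum_congr rfl fun k hk => ?_
    have hk' := mem_range.1 hk
    rw [← inv_neg]
    congr 1
    rw [eq_neg_iff_add_eq_zero, ← Nat.cast_add, show p - 1 - 1 - k + 1 + (k + 1) = p by omega]
    simp
  rw [sum_neg_distrib] at hr
  have : (2 : ZMod p) * ∑ k ∈ range (p - 1), (((k + 1 : ℕ) : ZMod p))⁻¹ = 0 := by
    linear_combination hr
  exact (mul_eq_zero.1 this).resolve_left h2

theorem sum_range_two_mul_alternating (F : ℕ → ZMod p) (h : ℕ) :
    ∑ k ∈ range (2 * h), (-1) ^ k * F k = ∑ k ∈ range (2 * h), F k -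
      2 * ∑ k ∈ range h, F (2 * k + 1) := by
  induction h with
  | zero => simp
  | succ h ih =>
    rw [show 2 * (h + 1) = 2 * h + 1 + 1 by ring, sum_range_succ, sum_range_succ, ih,
      sum_range_succ (fun k => F k), sum_range_succ (fun k => F k), sum_range_succ _ h, pow_succ,
      pow_mul]
    norm_num
    ring

theorem harmonic_half_eq (h q : ℕ) (hph : p = 2 * h + 1) (hq : 2 ^ (p - 1) = p * q + 1) :
    ∑ t ∈ range h, (((t + 1 : ℕ) : ZMod p))⁻¹ = -2 * q := by
  have h2 := two_ne_zero_zmod (p := p) (by omega)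
  have e := fermatQuotient_eq_alternating_sum q hq
  have z := sum_inv_eq_zero (p := p) (by omega)
  rw [show p - 1 = 2 * h by omega] at e z
  rw [sum_range_two_mul_alternating (fun k => (((k + 1 : ℕ) : ZMod p))⁻¹), z, mul_sum] at e
  have : ∑ k ∈ range h, (2 : ZMod p) * (((2 * k + 1 + 1 : ℕ) : ZMod p))⁻¹ =
      ∑ t ∈ range h, (((t + 1 : ℕ) : ZMod p))⁻¹ := by
    refine sum_congr rfl fun k _ => ?_
    rw [show 2 * k + 1 + 1 = 2 * (k + 1) by ring, Nat.cast_mul, mul_inv, ← mul_assoc,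
      Nat.cast_two, mul_inv_cancel₀ h2, one_mul]
  rw [this] at e
  linear_combination e

theorem centralBinom_eq_four_pow_mul_choose (h s : ℕ) (hph : p = 2 * h + 1) (hs : s ≤ h) :
    (s.centralBinom : ZMod p) = 4 ^ s * ((-1) ^ s * h.choose s) := by
  induction s with
  | zero => simp
  | succ s ih =>
    have hs0 : ((s + 1 : ℕ) : ZMod p) ≠ 0 := natCast_ne_zero_of_pos_of_lt (by omega) (by omega)
    have e1 := congrArg (Nat.cast : ℕ → ZMod p) (Nat.succ_mul_centralBinom_succ s)
    have e2 := congrArg (Nat.cast : ℕ → ZMod p) (Nat.choose_succ_right_eq h s)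
    have e3 : (2 * h + 1 : ZMod p) = 0 := by
      have : ((2 * h + 1 : ℕ) : ZMod p) = 0 := by rw [← hph]; simp
      simpa using this
    rw [Nat.cast_mul, Nat.cast_mul, Nat.cast_sub (by omega)] at e2
    rw [Nat.cast_mul, Nat.cast_mul, ih (by omega)] at e1
    apply mul_left_cancel₀ hs0
    rw [e1]
    push_cast at e2 ⊢
    rw [pow_succ, pow_succ]
    linear_combination 4 * 4 ^ s * (-1 : ZMod p) ^ s * e2 +
      2 * 4 ^ s * (-1 : ZMod p) ^ s * (h.choose s : ZMod p) * e3

theorem sum_centralBinom_div (h q : ℕ) (hph : p = 2 * h + 1) (hq : 2 ^ (p - 1) = p * q + 1) :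
    ∑ s ∈ range h, (s.centralBinom : ZMod p) / (4 ^ s * ((2 * s + 1 : ℕ) : ZMod p)) =
      -(-1) ^ h * q := by
  have h2 := two_ne_zero_zmod (p := p) (by omega)
  have h4 : (4 : ZMod p) ≠ 0 := by
    rw [show (4 : ZMod p) = 2 * 2 by norm_num]; exact mul_ne_zero h2 h2
  have e3 : (2 * h + 1 : ZMod p) = 0 := by
    have : ((2 * h + 1 : ℕ) : ZMod p) = 0 := by rw [← hph]; simp
    simpa using this
  have key : ∑ s ∈ range h, (s.centralBinom : ZMod p) / (4 ^ s * ((2 * s + 1 : ℕ) : ZMod p)) =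
      ∑ t ∈ range h, (-1) ^ h * 2⁻¹ *
        ((-1 : ZMod p) ^ t * h.choose (t + 1) / ((t + 1 : ℕ) : ZMod p)) := by
    rw [← sum_range_reflect]
    refine sum_congr rfl fun t ht => ?_
    have ht' := mem_range.1 ht
    rw [centralBinom_eq_four_pow_mul_choose h _ hph (by omega)]
    obtain ⟨s, hs⟩ : ∃ s, h = s + (t + 1) := ⟨h - (t + 1), by omega⟩
    have hs0 : ((t + 1 : ℕ) : ZMod p) ≠ 0 := natCast_ne_zero_of_pos_of_lt (by omega) (by omega)
    rw [show h - 1 - t = s by omega, hs, Nat.choose_symm_add]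
    have e5 : ((2 * s + 1 : ℕ) : ZMod p) = -2 * ((t + 1 : ℕ) : ZMod p) := by
      rw [hs] at e3; push_cast at e3 ⊢; linear_combination e3
    have e6 : (-1 : ZMod p) ^ (s + (t + 1)) * (-1) ^ t = -(-1) ^ s := by
      rw [← pow_add, show s + (t + 1) + t = s + (2 * t + 1) by ring, pow_add, pow_succ, pow_mul]
      norm_num
    rw [e5, mul_div_mul_left _ _ (pow_ne_zero _ h4)]
    have e7 : (-1 : ZMod p) ^ (s + (t + 1)) * 2⁻¹ * ((-1) ^ t * ((s + (t + 1)).choose (t + 1) : ZMod p) /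
        ((t + 1 : ℕ) : ZMod p)) = ((-1 : ZMod p) ^ (s + (t + 1)) * (-1) ^ t) * 2⁻¹ *
        (((s + (t + 1)).choose (t + 1) : ZMod p) / ((t + 1 : ℕ) : ZMod p)) := by ring
    rw [e7, e6]
    field_simp
  rw [key, ← mul_sum, sum_range_alternating_choose_div h (by omega), harmonic_half_eq h q hph hq]
  field_simp

end BinomialsModPrime

theorem pow_prime_pow_sub_one {p : ℕ} [Fact p.Prime] {a : ZMod p} (ha : a ≠ 0) (r : ℕ) :
    a ^ (p ^ r - 1) = 1 := by
  have hp : p.Prime := Fact.out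
  apply mul_right_cancel₀ ha
  rw [← pow_succ, Nat.sub_add_cancel (pow_pos hp.pos r), ZMod.pow_card_pow, one_mul]

theorem choose_four_mul_prime_pow_sub_one {p : ℕ} [Fact p.Prime] (hp2 : p ≠ 2) (r m : ℕ)
    (hm : m + 1 = p ^ r) : ((4 * m + 3).choose (2 * m + 1) : ZMod p) = 3 := by
  have hp : p.Prime := Fact.out
  have h := Nat.add_one_mul_choose_eq (4 * m + 3) (2 * m + 1)
  have h' : 2 * (4 * m + 3).choose (2 * m + 1) = (4 * p ^ r + 0).choose (2 * p ^ r + 0) := by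
    apply Nat.eq_of_mul_eq_mul_left (show 0 < 2 * m + 1 + 1 by omega)
    rw [show 4 * p ^ r + 0 = 4 * m + 3 + 1 by omega,
      show 2 * p ^ r + 0 = 2 * m + 1 + 1 by omega]
    linarith
  have h1 := congrArg (Nat.cast : ℕ → ZMod p) h'
  rw [choose_mul_prime_pow_add r 4 0 2 0 (pow_pos hp.pos r) (pow_pos hp.pos r)] at h1
  apply mul_left_cancel₀ (two_ne_zero_zmod hp2)
  have h3 : Nat.choose 4 2 = 6 := rfl
  rw [h3] at h1
  push_cast at h1
  rw [h1]
  norm_num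

theorem exists_G_eq_div {p : ℕ} [Fact p.Prime] (hp2 : p ≠ 2) (r k i : ℕ)
    (hn : k + i + 1 = p ^ r) (hi : 2 * i + 3 < p ^ r) :
    ∃ X : ℚ, G (p ^ r) k = (p : ℚ) ^ (2 * r) * X / (2 * i + 3 : ℕ) ∧
      ReducesTo p X (-3 * ((i + 1).centralBinom / 4 ^ (i + 1))) := by
  have hp : p.Prime := Fact.out
  have h2 := two_ne_zero_zmod hp2
  have h4 : (4 : ZMod p) ≠ 0 := by
    rw [show (4 : ZMod p) = 2 * 2 by norm_num]; exact mul_ne_zero h2 h2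
  have hodd : Even (k + i) := by
    have : Odd (p ^ r) := (hp.odd_of_ne_two hp2).pow
    rw [← hn] at this
    exact (Nat.odd_add_one.1 this |> Nat.not_odd_iff_even.1)
  have neg_one_ne : ∀ m : ℕ, (-1 : ZMod p) ^ m ≠ 0 := fun m =>
    pow_ne_zero _ (neg_ne_zero.2 one_ne_zero)
  have c1 := choose_mul_prime_pow_sub_one (p := p) 2 r (k + i) (by omega) (by omega)
  have c2 := choose_four_mul_prime_pow_sub_one hp2 r (k + i) hn
  have c3 := choose_mul_prime_pow_sub_one (p := p) 2 r (i + 1) (by omega) (by omega)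
  have c4 := choose_mul_prime_pow_sub_one (p := p) 2 r (2 * i + 1) (by omega) (by omega)
  have c5 := choose_mul_prime_pow_sub_one (p := p) 4 r (2 * i + 3) (by omega) (by omega)
  have c6 := choose_mul_prime_pow_sub_one (p := p) 1 r i (by omega) (by omega)
  rw [show 2 * p ^ r - 1 = 2 * k + 2 * i + 1 by omega] at c1 c3 c4
  rw [show 4 * (k + i) + 3 = 4 * k + 4 * i + 3 by ring,
    show 2 * (k + i) + 1 = 2 * k + 2 * i + 1 by ring] at c2
  rw [show 4 * p ^ r - 1 = 4 * k + 4 * i + 3 by omega] at c5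
  rw [show 1 * p ^ r - 1 = k + i by omega] at c6
  have c7 : (4 : ZMod p) ^ (2 * k + 3 * i + 1) = 4 ^ (i + 1) := by
    have := pow_prime_pow_sub_one h4 r
    rw [← hn, Nat.add_sub_cancel] at this
    rw [show 2 * k + 3 * i + 1 = (k + i) * 2 + (i + 1) by ring, pow_add, pow_mul, this]
    simp
  have n4 : ReducesTo p 4 4 := by simpa using ReducesTo.natCast (p := p) 4
  have n1 : ReducesTo p (-1) (-1) := by simpa using ReducesTo.intCast (p := p) (-1)
  have hG := G_eq_choose_quotient k i
  rw [hn, Nat.cast_pow, ← pow_mul, mul_comm r 2] at hG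
  refine ⟨_, hG, ?_⟩
  have R := ((((((((n1.pow (i + 1)).mul
    (.natCast ((2 * k + 2 * i + 1).choose (k + i)))).mul
    (.natCast ((4 * k + 4 * i + 3).choose (2 * k + 2 * i + 1)))).mul
    (.natCast ((2 * k + 2 * i + 1).choose (i + 1)))).mul
    ((ReducesTo.natCast ((2 * k + 2 * i + 1).choose (2 * i + 1))).pow 2)).mul
    ((ReducesTo.natCast ((4 * k + 4 * i + 3).choose (2 * i + 3))).inv
      (by rw [c5]; exact neg_one_ne _))).mul
    (((ReducesTo.natCast ((k + i).choose i)).pow 2).inv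
      (by rw [c6]; exact pow_ne_zero _ (neg_one_ne _)))).mul
    ((ReducesTo.natCast (i + 1).centralBinom).mul
      ((n4.pow (2 * k + 3 * i + 1)).inv (pow_ne_zero _ h4))))
  rw [c1, c2, c3, c4, c5, c6, c7, hodd.neg_one_pow] at R
  convert R using 1
  have s1 : (-1 : ZMod p) ^ (2 * i + 1) = -1 := by rw [pow_succ, pow_mul]; simp
  have s2 : (-1 : ZMod p) ^ (2 * i + 3) = -1 := by
    rw [show 2 * i + 3 = 2 * (i + 1) + 1 by ring, pow_succ, pow_mul]; simp
  have s3 : ((-1 : ZMod p) ^ i) ^ 2 = 1 := by rw [← pow_mul, mul_comm, pow_mul]; simp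
  have s4 : (-1 : ZMod p) ^ (i + 1) * (-1) ^ (i + 1) = 1 := by
    rw [← mul_pow]; simp
  rw [s1, s2, s3]
  rw [inv_neg, inv_one]
  linear_combination (3 * ((i + 1).centralBinom : ZMod p) * (4 ^ (i + 1))⁻¹) * s4

theorem reducesTo_prime_pow_mul_div {p : ℕ} [Fact p.Prime] (r b : ℕ) (hb0 : 0 < b)
    (hb : b < p ^ (r + 1)) {X : ℚ} {a : ZMod p} (hX : ReducesTo p X a) :
    ReducesTo p ((p : ℚ) ^ r * X / b) (if p ^ r ∣ b then a / (b / p ^ r : ℕ) else 0) := by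
  have hp : p.Prime := Fact.out
  have hp0 : (p : ℚ) ≠ 0 := by exact_mod_cast hp.ne_zero
  split_ifs with h
  · obtain ⟨t, rfl⟩ := h
    have ht : t < p := by
      rw [pow_succ] at hb; exact Nat.lt_of_mul_lt_mul_left hb
    have ht0 : 0 < t := Nat.pos_of_mul_pos_left hb0
    rw [Nat.mul_div_cancel_left _ (pow_pos hp.pos r)]
    push_cast
    rw [mul_div_mul_left _ _ (pow_ne_zero _ hp0)]
    exact hX.div (.natCast t) (natCast_ne_zero_of_pos_of_lt ht0 ht)
  · obtain ⟨e, u, hu, rfl⟩ := Nat.exists_eq_pow_mul_and_not_dvd hb0.ne' p hp.ne_one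
    have her : e < r := by
      by_contra hc
      exact h ((pow_dvd_pow p (by omega)).trans (Dvd.intro _ rfl))
    obtain ⟨f, rfl⟩ : ∃ f, r = e + (f + 1) := ⟨r - e - 1, by omega⟩
    have hu' : (u : ZMod p) ≠ 0 := by rwa [Ne, ZMod.natCast_eq_zero_iff]
    have R := (((ReducesTo.natCast (p := p) p).pow (f + 1)).mul hX).div (.natCast u) hu'
    rw [CharP.cast_eq_zero (ZMod p) p, zero_pow (by omega), zero_mul, zero_div] at R
    push_cast
    rwa [pow_add, mul_assoc ((p : ℚ) ^ e), mul_div_mul_left _ _ (pow_ne_zero _ hp0)]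

theorem centralBinom_div_four_pow_lift {p : ℕ} [Fact p.Prime] (hp2 : p ≠ 2) (r w s : ℕ)
    (hw : p ^ r = 2 * w + 1) :
    ((s * p ^ r + w).centralBinom : ZMod p) / 4 ^ (s * p ^ r + w) =
      (-1) ^ w * (s.centralBinom / 4 ^ s) := by
  have h2 := two_ne_zero_zmod hp2
  have hc := choose_mul_prime_pow_add (p := p) r (2 * s) (2 * w) s w (by omega) (by omega)
  have hm := choose_mul_prime_pow_sub_one (p := p) 1 r w (by omega) (by omega)
  have h4 := pow_prime_pow_sub_one h2 r
  rw [show 1 * p ^ r - 1 = 2 * w by omega] at hm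
  rw [show p ^ r - 1 = 2 * w by omega, pow_mul] at h4
  rw [hm] at hc
  norm_num at h4
  rw [Nat.centralBinom, show 2 * (s * p ^ r + w) = 2 * s * p ^ r + 2 * w by ring, hc, pow_add, h4,
    mul_comm s, pow_mul, ZMod.pow_card_pow, Nat.centralBinom]
  ring

theorem sum_filter_dvd_two_mul_add_three {M : Type*} [AddCommMonoid M] (F : ℕ → ℕ → M)
    (P w h : ℕ) (hP : P = 2 * w + 1)
    (hw : 0 < w) :
    ∑ i ∈ range ((P * (2 * h + 1) - 3) / 2),
        (if P ∣ 2 * i + 3 then F (i + 1) ((2 * i + 3) / P) else 0) =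
      ∑ s ∈ range h, F (s * P + w) (2 * s + 1) := by
  have hP0 : 0 < P := by omega
  rw [← sum_filter]
  symm
  refine sum_bij (fun s _ => s * P + w - 1) ?_ ?_ ?_ ?_
  · intro s hs
    have hs' := mem_range.1 hs
    have e : 2 * (s * P + w - 1) + 3 = P * (2 * s + 1) := by
      have : P * (2 * s + 1) = 2 * (s * P) + P := by ring
      omega
    rw [mem_filter, mem_range, e]
    refine ⟨?_, Dvd.intro _ rfl⟩
    have : P * (2 * s + 1) + 2 * P ≤ P * (2 * h + 1) := by
      have : P * (2 * s + 1 + 2) ≤ P * (2 * h + 1) := Nat.mul_le_mul_left _ (by omega)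
      linarith
    omega
  · intro s _ t _ hst
    have : s * P = t * P := by omega
    exact Nat.eq_of_mul_eq_mul_right hP0 this
  · intro i hi
    rw [mem_filter, mem_range] at hi
    obtain ⟨hi, t, ht⟩ := hi
    have hodd : Odd t := by
      have : Odd (P * t) := ht ▸ ⟨i + 1, by ring⟩
      exact (Nat.odd_mul.1 this).2
    obtain ⟨s, rfl⟩ := hodd
    have e : P * (2 * s + 1) = 2 * (s * P) + P := by ring
    refine ⟨s, ?_, by omega⟩
    rw [mem_range]
    have : P * (2 * s + 1) < P * (2 * h + 1) := by omega
    have := Nat.lt_of_mul_lt_mul_left this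
    omega
  · intro s _
    have e : 2 * (s * P + w - 1) + 3 = P * (2 * s + 1) := by
      have : P * (2 * s + 1) = 2 * (s * P) + P := by ring
      omega
    rw [e, Nat.mul_div_cancel_left _ hP0, show s * P + w - 1 + 1 = s * P + w by omega]

theorem stmt_12 (p : ℕ) (hp : p.Prime) (hp3 : 3 < p) (r : ℕ) (hr : 2 ≤ r) :
    pcong p (r + 2) (∑ k ∈ Icc ((p ^ r + 3) / 2) (p ^ r - 1), G (p ^ r) k)
      ((-1) ^ ((p ^ r - 1) / 2) * 3 * (p : ℚ) ^ (r + 1) *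
        (((2 : ℚ) ^ (p - 1) - 1) / (p : ℚ))) := by
  have : Fact p.Prime := ⟨hp⟩
  have hp2 : p ≠ 2 := by omega
  have hp0 : (p : ℚ) ≠ 0 := by exact_mod_cast hp.ne_zero
  obtain ⟨R, rfl⟩ : ∃ R, r = R + 1 := ⟨r - 1, by omega⟩
  obtain ⟨h, hh⟩ : Odd p := hp.odd_of_ne_two hp2
  obtain ⟨w, hw⟩ : Odd (p ^ R) := (hp.odd_of_ne_two hp2).pow
  have hw0 : 0 < w := by
    have : p ^ 1 ≤ p ^ R := Nat.pow_le_pow_right hp.pos (by omega)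
    rw [pow_one] at this
    omega
  have hn : p ^ (R + 1) = p ^ R * (2 * h + 1) := by rw [pow_succ]; congr 1
  have hn2 : p ^ (R + 1) = 2 * (2 * w * h + w + h) + 1 := by rw [hn, hw]; ring
  obtain ⟨q, hq⟩ : ∃ q, 2 ^ (p - 1) = p * q + 1 := by
    have h1 : ((2 ^ (p - 1) - 1 : ℕ) : ZMod p) = 0 := by
      rw [Nat.cast_sub Nat.one_le_two_pow]
      push_cast
      rw [ZMod.pow_card_sub_one_eq_one (two_ne_zero_zmod hp2), sub_self]
    obtain ⟨q, hq⟩ := (ZMod.natCast_eq_zero_iff _ p).1 h1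
    exact ⟨q, by have := Nat.one_le_two_pow (n := p - 1); omega⟩
  have hqq : ((2 : ℚ) ^ (p - 1) - 1) / p = q := by
    have : ((2 ^ (p - 1) : ℕ) : ℚ) = ((p * q + 1 : ℕ) : ℚ) := by rw [hq]
    push_cast at this
    rw [this]
    field_simp
    ring
  have reindex : ∑ k ∈ Icc ((p ^ (R + 1) + 3) / 2) (p ^ (R + 1) - 1), G (p ^ (R + 1)) k =
      ∑ i ∈ range ((p ^ (R + 1) - 3) / 2), G (p ^ (R + 1)) (p ^ (R + 1) - 1 - i) := by
    refine sum_nbij' (fun k => p ^ (R + 1) - 1 - k) (fun i => p ^ (R + 1) - 1 - i) ?_ ?_ ?_ ?_ ?_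
    · intro k hk
      rw [mem_Icc] at hk
      rw [mem_range]
      omega
    · intro i hi
      rw [mem_range] at hi
      rw [mem_Icc]
      omega
    · intro k hk
      rw [mem_Icc] at hk
      omega
    · intro i hi
      rw [mem_range] at hi
      omega
    · intro k hk
      rw [mem_Icc] at hk
      congr 1
      omega
  have terms : ∀ i : ℕ, ∃ Y : ℚ, i ∈ range ((p ^ (R + 1) - 3) / 2) →
      G (p ^ (R + 1)) (p ^ (R + 1) - 1 - i) = (p : ℚ) ^ (R + 2) * Y ∧
      ReducesTo p Y (if p ^ R ∣ 2 * i + 3 then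
        -3 * ((i + 1).centralBinom / 4 ^ (i + 1)) / ((2 * i + 3) / p ^ R : ℕ) else 0) := by
    intro i
    by_cases hi : i ∈ range ((p ^ (R + 1) - 3) / 2)
    · have hi' := mem_range.1 hi
      obtain ⟨X, hX, hred⟩ := exists_G_eq_div hp2 (R + 1) (p ^ (R + 1) - 1 - i) i (by omega)
        (by omega)
      refine ⟨(p : ℚ) ^ R * X / (2 * i + 3 : ℕ), fun _ => ⟨?_, ?_⟩⟩
      · rw [hX, show 2 * (R + 1) = R + 2 + R by ring, pow_add]; ring
      · exact reducesTo_prime_pow_mul_div R (2 * i + 3) (by omega) (by omega) hred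
    · exact ⟨0, fun h => absurd h hi⟩
  choose Y hY using terms
  have hsum : ReducesTo p (∑ i ∈ range ((p ^ (R + 1) - 3) / 2), Y i) ((-1) ^ (w + h) * 3 * q) := by
    convert ReducesTo.sum _ fun i hi => (hY i hi).2 using 1
    rw [hn, sum_filter_dvd_two_mul_add_three
      (fun j t => -3 * ((j.centralBinom : ZMod p) / 4 ^ j) / (t : ZMod p)) (p ^ R) w h hw hw0]
    simp only [centralBinom_div_four_pow_lift hp2 R w _ hw]
    have e := sum_centralBinom_div h q hh hq
    have e' : ∑ s ∈ range h, -3 * ((-1) ^ w * ((s.centralBinom : ZMod p) / 4 ^ s)) /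
        ((2 * s + 1 : ℕ) : ZMod p) = ∑ s ∈ range h, (-3 * (-1) ^ w) *
        ((s.centralBinom : ZMod p) / (4 ^ s * ((2 * s + 1 : ℕ) : ZMod p))) := by
      refine sum_congr rfl fun s _ => ?_
      rw [← div_div]; ring
    rw [e', ← mul_sum, e, pow_add]
    ring
  have hrhs : ReducesTo p ((-1) ^ (w + h) * 3 * q) ((-1) ^ (w + h) * 3 * q) := by
    simpa using ReducesTo.intCast (p := p) ((-1) ^ (w + h) * 3 * q)
  have key := hsum.pcong_pow_mul hrhs (R + 2)
  rw [reindex, sum_congr rfl fun i hi => (hY i hi).1, ← mul_sum, hqq]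
  have sgn : (-1 : ℚ) ^ ((p ^ (R + 1) - 1) / 2) = (-1) ^ (w + h) := by
    rw [show (p ^ (R + 1) - 1) / 2 = 2 * (w * h) + (w + h) by
      have : 2 * w * h = 2 * (w * h) := by ring
      omega, pow_add, pow_mul]
    simp
  rw [sgn]
  convert key using 1
  ring
end
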